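/- Let d ≥ 2 and n ≥ 5, and let 0 < δ < 1/(2⌊n/2⌋²). Then there exists Q₀ such that for every odd prime power q ≥ Q₀ the following holds. Let Q be a non-degenerate quadratic form on F_q^d with associated distance φ(x,y) = Q(x−y), fix t ∈ F_q \ {0}, let E ⊆ F_q^d, and let C_n denote the number of n-tuples (x_1, …, x_n) ∈ E^n with φ(x_i, x_{i+1}) = t for 1 ≤ i ≤ n−1 and φ(x_n, x_1) = t. If |E| ≥ q^{(1/2)(d + 2 − (k−2)/(k−1) + δ)} when n = 2k is even, respectively |E| ≥ q^{(1/2)(d + 2 − (2k−3)/(2k−1) + δ)} when n = 2k+1 is odd, then | C_n − |E|^n/q^n | ≤ ( 36 + 80 · 6^{⌊n/2⌋ − 2} + 12⌊n/2⌋ ) (|E|^n/q^n) q^{−(n/2 − 1)δ}. -/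

import Mathlib

open Finset
namespace Kloo
open Polynomial

/-- weighted degree encoding -/
noncomputable def enc {K : Type*} [Field K] {h : K[X]} (g : ℕ) (u : QuadraticAlgebra K[X] h 0) : K[X] :=
  expand K 2 u.re + X ^ (2 * g + 1) * expand K 2 u.im

lemma degree_add_max {K : Type*} [Field K] (P S : K[X]) (hPS : P ≠ 0 → S ≠ 0 → P.natDegree ≠ S.natDegree) :
    (P + S).degree = max P.degree S.degree := by
  by_cases hP : P = 0
  · simp [hP]
  by_cases hS : S = 0
  · simp [hS]
  have h1 := hPS hP hS
  rcases lt_or_gt_of_ne h1 with h2 | h2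
  · have h3 := degree_lt_degree h2
    rw [degree_add_eq_right_of_degree_lt h3, max_eq_right h3.le]
  · have h3 := degree_lt_degree h2
    rw [degree_add_eq_left_of_degree_lt h3, max_eq_left h3.le]

lemma degree_eq_of {K : Type*} [Field K] (P S : K[X]) (h0 : P = 0 ↔ S = 0) (h : P.natDegree = S.natDegree) :
    P.degree = S.degree := by
  by_cases hP : P = 0
  · rw [hP, h0.1 hP]
  · rw [degree_eq_natDegree hP, degree_eq_natDegree (fun hS => hP (h0.2 hS)), h]

lemma enc_degree {K : Type*} [Field K] {h : K[X]} (g : ℕ) (hdeg : h.natDegree = 2 * g + 1)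
    (u : QuadraticAlgebra K[X] h 0) :
    (enc g u).degree = max (u.re ^ 2).degree (h * u.im ^ 2).degree := by
  have hh : h ≠ 0 := by rintro rfl; simp at hdeg
  have e1 : (expand K 2 u.re).degree = (u.re ^ 2).degree := by
    apply degree_eq_of
    · rw [expand_eq_zero two_pos]; simp
    · simp [natDegree_expand]; ring
  have e2 : (X ^ (2 * g + 1) * expand K 2 u.im).degree = (h * u.im ^ 2).degree := by
    apply degree_eq_of
    · simp [hh, expand_eq_zero]
    · by_cases hu : u.im = 0
      · simp [hu]
      · rw [natDegree_mul (by simp) (by rwa [Ne, expand_eq_zero two_pos]),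
          natDegree_mul hh (by simpa using hu), hdeg]
        simp [natDegree_expand]; ring
  rw [enc, degree_add_max, e1, e2]
  intro h1 h2
  rw [natDegree_eq_of_degree_eq e1, natDegree_eq_of_degree_eq e2]
  have hu : u.im ≠ 0 := by rintro h; simp [h] at h2
  rw [natDegree_mul hh (by simpa using hu), hdeg]
  simp; omega

lemma norm_degree {K : Type*} [Field K] {h : K[X]} (g : ℕ) (hdeg : h.natDegree = 2 * g + 1)
    (u : QuadraticAlgebra K[X] h 0) :
    (QuadraticAlgebra.norm u).degree = (enc g u).degree := by
  have hh : h ≠ 0 := by rintro rfl; simp at hdeg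
  rw [enc_degree g hdeg]
  have : QuadraticAlgebra.norm u = u.re ^ 2 + -(h * u.im ^ 2) := by
    rw [QuadraticAlgebra.norm_def]; ring
  rw [this, degree_add_max, degree_neg]
  intro h1 h2
  have hu : u.im ≠ 0 := by rintro h; simp [h] at h2
  rw [natDegree_neg, natDegree_mul hh (by simpa using hu), hdeg]
  simp; omega

lemma enc_mul {K : Type*} [Field K] {h : K[X]} (g : ℕ) (hdeg : h.natDegree = 2 * g + 1)
    (u v : QuadraticAlgebra K[X] h 0) :
    (enc g (u * v)).degree = (enc g u).degree + (enc g v).degree := by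
  simp only [← norm_degree g hdeg, map_mul, degree_mul]

lemma enc_pow {K : Type*} [Field K] {h : K[X]} (g : ℕ) (hdeg : h.natDegree = 2 * g + 1)
    (u : QuadraticAlgebra K[X] h 0) (n : ℕ) :
    (enc g (u ^ n)).degree = n • (enc g u).degree := by
  simp only [← norm_degree g hdeg, map_pow, degree_pow]

lemma enc_eq_zero {K : Type*} [Field K] {h : K[X]} (g : ℕ) (hdeg : h.natDegree = 2 * g + 1)
    (u : QuadraticAlgebra K[X] h 0) : enc g u = 0 ↔ u = 0 := by
  have hh : h ≠ 0 := by rintro rfl; simp at hdeg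
  constructor
  · intro hu
    have := enc_degree g hdeg u
    rw [hu, degree_zero, eq_comm, _root_.max_eq_bot] at this
    obtain ⟨h1, h2⟩ := this
    rw [degree_eq_bot] at h1 h2
    ext1
    · simpa using h1
    · simpa [hh] using h2
  · rintro rfl; simp [enc]

noncomputable def encHom {K : Type*} [Field K] {h : K[X]} (g : ℕ) : QuadraticAlgebra K[X] h 0 →+ K[X] where
  toFun := enc g
  map_zero' := by simp [enc]
  map_add' u v := by simp [enc]; ring

/-- evaluation at a point of the curve -/
noncomputable def ev {K : Type*} [Field K] (h : K[X]) (x z : K) (hz : z ^ 2 = h.eval x) :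
    QuadraticAlgebra K[X] h 0 →+* K where
  toFun u := u.re.eval x + z * u.im.eval x
  map_zero' := by simp
  map_one' := by simp [QuadraticAlgebra.re_one, QuadraticAlgebra.im_one]
  map_add' u v := by simp; ring
  map_mul' u v := by
    simp
    linear_combination (-(u.im.eval x * v.im.eval x)) * hz

lemma card_points_le {K : Type*} [Field K] [Fintype K] [DecidableEq K] (h2 : (2 : K) ≠ 0)
    (h : K[X]) (u : QuadraticAlgebra K[X] h 0) (hu : QuadraticAlgebra.norm u ≠ 0)
    (hv : ∀ x z (hz : z ^ 2 = h.eval x), ev h x z hz u = 0) :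
    (univ.filter (fun x : K × K => x.2 ^ 2 = h.eval x.1)).card ≤ (QuadraticAlgebra.norm u).natDegree := by
  have hN : QuadraticAlgebra.norm u = u.re ^ 2 - h * u.im ^ 2 := by
    rw [QuadraticAlgebra.norm_def]; ring
  set N := QuadraticAlgebra.norm u with hNdef
  have hroot : ∀ x z : K, z ^ 2 = h.eval x → N.IsRoot x := by
    intro x z hz
    have := hv x z hz
    simp only [ev, RingHom.coe_mk, MonoidHom.coe_mk, OneHom.coe_mk] at this
    rw [IsRoot.def, hN]
    simp
    linear_combination (u.re.eval x - z * u.im.eval x) * this + (u.im.eval x)^2 * hz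
  have hfib : ∀ x : K, ((univ.filter (fun x : K × K => x.2 ^ 2 = h.eval x.1)).filter (fun y => y.1 = x)).card ≤
      N.roots.count x := by
    intro x
    rw [count_roots]
    by_cases hex : ∃ z : K, z ^ 2 = h.eval x
    · obtain ⟨z, hz⟩ := hex
      have hsub : ((univ.filter (fun x : K × K => x.2 ^ 2 = h.eval x.1)).filter (fun y => y.1 = x)) ⊆
          {(x, z), (x, -z)} := by
        rintro ⟨x', z'⟩ hm
        simp only [mem_filter, mem_univ, true_and] at hm
        obtain ⟨h3, rfl⟩ := hm
        have : (z' - z) * (z' + z) = 0 := by linear_combination h3 - hz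
        rcases mul_eq_zero.1 this with h4 | h4
        · simp [sub_eq_zero.1 h4]
        · simp [eq_neg_of_add_eq_zero_left h4]
      refine (card_le_card hsub).trans ?_
      by_cases hz0 : z = 0
      · simp only [hz0, neg_zero, mem_singleton, insert_eq_of_mem, card_singleton]
        exact (rootMultiplicity_pos hu).2 (hroot x z hz)
      · refine card_le_two.trans ?_
        rw [le_rootMultiplicity_iff hu]
        have e1 := hv x z hz
        have e2 := hv x (-z) (by rw [neg_sq, hz])
        simp only [ev, RingHom.coe_mk, MonoidHom.coe_mk, OneHom.coe_mk] at e1 e2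
        have e3 : u.re.eval x = 0 := by
          have : 2 * u.re.eval x = 0 := by linear_combination e1 + e2
          exact (mul_eq_zero.1 this).resolve_left h2
        have e4 : u.im.eval x = 0 := by
          have : z * u.im.eval x = 0 := by linear_combination e1 - e3
          exact (mul_eq_zero.1 this).resolve_left hz0
        rw [hN]
        have d1 := dvd_iff_isRoot.2 e3
        have d2 := dvd_iff_isRoot.2 e4
        exact dvd_sub (pow_dvd_pow_of_dvd d1 2) (dvd_mul_of_dvd_right (pow_dvd_pow_of_dvd d2 2) _)
    · have : ((univ.filter (fun x : K × K => x.2 ^ 2 = h.eval x.1)).filter (fun y => y.1 = x)) = ∅ := by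
        rw [filter_eq_empty_iff]
        rintro ⟨x', z'⟩ hm rfl
        simp only [mem_filter, mem_univ, true_and] at hm
        exact hex ⟨z', hm⟩
      rw [this]; simp
  calc _ = ∑ x : K, ((univ.filter (fun x : K × K => x.2 ^ 2 = h.eval x.1)).filter (fun y => y.1 = x)).card :=
        card_eq_sum_card_fiberwise (fun _ _ => mem_coe.2 (mem_univ _))
    _ ≤ ∑ x : K, N.roots.count x := sum_le_sum (fun x _ => hfib x)
    _ = N.roots.card := by
        rw [Multiset.sum_count_eq_card (fun x _ => mem_univ x)]
    _ ≤ _ := card_roots' _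

theorem bombieri {K : Type*} [Field K] [Fintype K] [DecidableEq K] (p e g : ℕ) [Fact p.Prime]
    [CharP K p] (hp : p ≠ 2) (hcard : Fintype.card K = (p ^ e) ^ 2) (h : K[X])
    (hdeg : h.natDegree = 2 * g + 1) (hR : (g + 1) ^ 2 < p ^ e) :
    (univ.filter (fun x : K × K => x.2 ^ 2 = h.eval x.1)).card ≤ (p ^ e) ^ 2 + (2 * g + 1) * p ^ e := by
  have hodd : Odd (p ^ e) := (Nat.Prime.odd_of_ne_two Fact.out hp).pow
  have h2 : (2 : K) ≠ 0 := Ring.two_ne_zero (by rw [ringChar.eq K p]; exact hp)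
  set R := p ^ e with hRdef
  obtain ⟨r, hr⟩ := hodd
  have hrg : g < r := by nlinarith
  -- a = r+1, b = r - g, I = r+1+g, I' = r+1
  have : CharP (QuadraticAlgebra K[X] h 0) p :=
    charP_of_injective_algebraMap (algebraMap K (QuadraticAlgebra K[X] h 0)).injective p
  let ι := Fin (r + 1 + g) ⊕ Fin (r + 1)
  let D := ι → ((Fin (r + 1) → K) × (Fin (r - g) → K))
  let kk : ι → QuadraticAlgebra K[X] h 0 := Sum.elim (fun i => ⟨X ^ (i : ℕ), 0⟩) (fun i => ⟨0, X ^ (i : ℕ)⟩)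
  let H : D → ι → QuadraticAlgebra K[X] h 0 := fun v i =>
    ⟨((degreeLTEquiv K (r + 1)).symm (v i).1 : K[X]), ((degreeLTEquiv K (r - g)).symm (v i).2 : K[X])⟩
  have Hsub : ∀ v v' i, H v i - H v' i = H (v - v') i := by
    intro v v' i
    have e : (v - v') i = v i - v' i := rfl
    ext1
    · simp only [H, e, QuadraticAlgebra.re_sub, Prod.fst_sub, map_sub]; rfl
    · simp only [H, e, QuadraticAlgebra.im_sub, Prod.snd_sub, map_sub]; rfl
  have Hdeg : ∀ v i, (enc g (H v i)).degree < (R : ℕ) := by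
    intro v i
    rw [enc_degree g hdeg, max_lt_iff]
    have b1 : (H v i).re.degree < (r + 1 : ℕ) :=
      mem_degreeLT.1 ((degreeLTEquiv K (r + 1)).symm (v i).1).2
    have b2 : (H v i).im.degree < (r - g : ℕ) :=
      mem_degreeLT.1 ((degreeLTEquiv K (r - g)).symm (v i).2).2
    have hh : h ≠ 0 := by rintro rfl; simp at hdeg
    constructor
    · by_cases h0 : (H v i).re = 0
      · simp [h0]
      · rw [degree_eq_natDegree h0] at b1
        rw [degree_eq_natDegree (by simpa using h0), natDegree_pow]
        norm_cast at b1 ⊢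
        omega
    · by_cases h0 : (H v i).im = 0
      · simp [h0]
      · rw [degree_eq_natDegree h0] at b2
        rw [degree_eq_natDegree (by simp [h0, hh]), natDegree_mul hh (by simpa using h0), natDegree_pow, hdeg]
        norm_cast at b2 ⊢
        omega
  let kd : ι → ℕ := Sum.elim (fun i => 2 * (i : ℕ)) (fun i => 2 * (i : ℕ) + (2 * g + 1))
  have kkdeg : ∀ i, (enc g (kk i)).degree = (kd i : ℕ) := by
    have hh : h ≠ 0 := by rintro rfl; simp at hdeg
    rintro (i | i)
    · rw [enc_degree g hdeg]
      simp [kk, kd, degree_X_pow]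
    · rw [enc_degree g hdeg]
      simp [kk, kd, degree_X_pow, degree_eq_natDegree hh, hdeg]
      ring
  have kdle : ∀ i, kd i ≤ R + 2 * g := by
    rintro (i | i) <;> simp only [kd, Sum.elim_inl, Sum.elim_inr] <;> omega
  have kdinj : Function.Injective kd := by
    rintro (i | i) (j | j) hij <;> simp only [kd, Sum.elim_inl, Sum.elim_inr] at hij
    · congr 1; ext; omega
    · omega
    · omega
    · congr 1; ext; omega
  let S : D → QuadraticAlgebra K[X] h 0 := fun v => ∑ i, (H v i) ^ R * kk i
  have Ssub : ∀ v v', S v - S v' = S (v - v') := by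
    intro v v'
    simp only [S, ← sum_sub_distrib]
    refine sum_congr rfl fun i _ => ?_
    rw [← Hsub, hRdef, sub_pow_char_pow, sub_mul]
  have Sdeg : ∀ v, (enc g (S v)).degree ≤ (R ^ 2 + 2 * g : ℕ) := by
    intro v
    have : enc g (S v) = ∑ i, enc g ((H v i) ^ R * kk i) := map_sum (encHom g) _ _
    rw [this]
    refine (degree_sum_le _ _).trans (Finset.sup_le fun i _ => ?_)
    rw [enc_mul g hdeg, enc_pow g hdeg, kkdeg]
    have := Hdeg v i
    by_cases h0 : enc g (H v i) = 0
    · rw [h0, degree_zero, nsmul_eq_mul]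
      have : (R : WithBot ℕ) * ⊥ = ⊥ := WithBot.mul_bot (by norm_cast; omega)
      rw [this]; simp
    · rw [degree_eq_natDegree h0] at this ⊢
      have h3 := kdle i
      rw [nsmul_eq_mul]
      norm_cast at this ⊢
      nlinarith
  -- pigeonhole
  let T : D → (Fin ((R ^ 2 + 1) / 2 + g) → K) × (Fin ((R ^ 2 + 1) / 2) → K) := fun v =>
    (fun j => (S v).re.coeff j, fun j => (S v).im.coeff j)
  have hR2 : R ^ 2 = 2 * (2 * r * r + 2 * r) + 1 := by rw [hr]; ring
  have hcardlt : Fintype.card ((Fin ((R ^ 2 + 1) / 2 + g) → K) × (Fin ((R ^ 2 + 1) / 2) → K)) < Fintype.card D := by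
    simp only [D, ι, Fintype.card_prod, Fintype.card_pi, Fintype.card_fin, prod_const, card_univ, Fintype.card_sum]
    rw [← pow_add, ← pow_add, ← pow_mul (Fintype.card K)]
    apply Nat.pow_lt_pow_right
    · rw [hcard]; nlinarith
    · have : (R ^ 2 + 1) / 2 = 2 * r * r + 2 * r + 1 := by omega
      rw [this]
      obtain ⟨c, rfl⟩ : ∃ c, r = g + c := ⟨r - g, by omega⟩
      have : g + c - g = c := by omega
      rw [this]
      nlinarith
  obtain ⟨v, v', hne, hT⟩ := Fintype.exists_ne_map_eq_of_card_lt T hcardlt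
  have hS0 : S (v - v') = 0 := by
    rw [← Ssub, sub_eq_zero]
    have hh : h ≠ 0 := by rintro rfl; simp at hdeg
    have key : ∀ v, (∀ j, (R ^ 2 + 1) / 2 + g ≤ j → (S v).re.coeff j = 0) ∧
        (∀ j, (R ^ 2 + 1) / 2 ≤ j → (S v).im.coeff j = 0) := by
      intro v
      have h1 := Sdeg v
      rw [enc_degree g hdeg, max_le_iff] at h1
      obtain ⟨h1, h3⟩ := h1
      constructor
      · intro j hj
        by_contra hc
        have h4 := le_natDegree_of_ne_zero hc
        have h5 : (S v).re ≠ 0 := by rintro h; simp [h] at hc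
        rw [degree_eq_natDegree (by simpa using h5), natDegree_pow] at h1
        norm_cast at h1
        omega
      · intro j hj
        by_contra hc
        have h4 := le_natDegree_of_ne_zero hc
        have h5 : (S v).im ≠ 0 := by rintro h; simp [h] at hc
        rw [degree_eq_natDegree (by simp [h5, hh]), natDegree_mul hh (by simpa using h5), natDegree_pow, hdeg] at h3
        norm_cast at h3
        omega
    ext j
    · by_cases hj : j < (R ^ 2 + 1) / 2 + g
      · exact congrFun (congrArg Prod.fst hT) ⟨j, hj⟩
      · rw [(key v).1 j (by omega), (key v').1 j (by omega)]
    · by_cases hj : j < (R ^ 2 + 1) / 2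
      · exact congrFun (congrArg Prod.snd hT) ⟨j, hj⟩
      · rw [(key v).2 j (by omega), (key v').2 j (by omega)]
  set w := v - v' with hw
  have hw0 : w ≠ 0 := sub_ne_zero.2 hne
  obtain ⟨i0, hi0⟩ : ∃ i, H w i ≠ 0 := by
    by_contra hc
    push Not at hc
    apply hw0
    funext i
    have := hc i
    have r1 := congrArg QuadraticAlgebra.re this
    have r2 := congrArg QuadraticAlgebra.im this
    simp only [H, QuadraticAlgebra.re_zero, QuadraticAlgebra.im_zero, ZeroMemClass.coe_eq_zero,
      LinearEquiv.map_eq_zero_iff] at r1 r2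
    exact Prod.ext r1 r2
  let Ψ : QuadraticAlgebra K[X] h 0 := ∑ i, H w i * (kk i) ^ R
  have hencΨ : enc g Ψ = ∑ i, enc g (H w i * (kk i) ^ R) := map_sum (encHom g) _ _
  have hterm : ∀ i, H w i ≠ 0 → (enc g (H w i * (kk i) ^ R)).degree =
      ((enc g (H w i)).natDegree + R * kd i : ℕ) := by
    intro i hi
    rw [enc_mul g hdeg, enc_pow g hdeg, kkdeg, degree_eq_natDegree (by rwa [Ne, enc_eq_zero g hdeg])]
    simp
  have hlt : ∀ i, H w i ≠ 0 → (enc g (H w i)).natDegree < R := by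
    intro i hi
    have := Hdeg w i
    rw [degree_eq_natDegree (by rwa [Ne, enc_eq_zero g hdeg])] at this
    exact_mod_cast this
  have hdegΨ : (enc g Ψ).degree = univ.sup fun i => (enc g (H w i * (kk i) ^ R)).degree := by
    rw [hencΨ]
    apply degree_sum_eq_of_disjoint
    rintro i ⟨-, hi⟩ j ⟨-, hj⟩ hij heq
    have hi' : H w i ≠ 0 := by rintro h; apply hi; rw [h]; simp [enc]
    have hj' : H w j ≠ 0 := by rintro h; apply hj; rw [h]; simp [enc]
    simp only [Function.onFun, Function.comp] at heq
    rw [hterm i hi', hterm j hj'] at heq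
    have heq' : (enc g (H w i)).natDegree + R * kd i = (enc g (H w j)).natDegree + R * kd j := by
      exact_mod_cast heq
    apply hij
    apply kdinj
    have l1 := hlt i hi'
    have l2 := hlt j hj'
    have hRpos : 0 < R := by omega
    have m1 : (enc g (H w i)).natDegree + R * kd i = _ := rfl
    have := congrArg (· / R) heq'
    simpa [Nat.add_mul_div_left _ _ hRpos, Nat.div_eq_of_lt l1, Nat.div_eq_of_lt l2] using this
  have hΨ0 : enc g Ψ ≠ 0 := by
    intro h0
    rw [h0, degree_zero] at hdegΨ
    have := Finset.le_sup (f := fun i => (enc g (H w i * (kk i) ^ R)).degree) (mem_univ i0)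
    rw [← hdegΨ, hterm i0 hi0, le_bot_iff] at this
    exact WithBot.coe_ne_bot this
  have hΨdeg : (enc g Ψ).degree ≤ (R ^ 2 + (2 * g + 1) * R : ℕ) := by
    rw [hdegΨ]
    refine Finset.sup_le fun i _ => ?_
    by_cases hi : H w i = 0
    · rw [hi]; simp [enc]
    · rw [hterm i hi]
      have l1 := hlt i hi
      have l2 := kdle i
      norm_cast
      nlinarith
  have hnd : (QuadraticAlgebra.norm Ψ).degree = (enc g Ψ).degree := norm_degree g hdeg Ψ
  have hfinal := card_points_le h2 h Ψ (by
      intro h0; rw [h0, degree_zero] at hnd; exact hΨ0 (degree_eq_bot.1 hnd.symm)) (by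
    intro x z hz
    have hfrob : ∀ c : K, c ^ (R ^ 2) = c := by
      intro c; rw [← hcard]; exact FiniteField.pow_card c
    have : (ev h x z hz Ψ) ^ R = ev h x z hz (S w) := by
      simp only [Ψ, S, map_sum, map_mul, map_pow]
      rw [hRdef, sum_pow_char_pow]
      refine sum_congr rfl fun i _ => ?_
      rw [mul_pow, ← hRdef, ← pow_mul, ← sq, hfrob]
    rw [hS0, map_zero] at this
    exact pow_eq_zero_iff (by omega) |>.1 this)
  refine hfinal.trans ?_
  rw [← natDegree_eq_of_degree_eq hnd.symm]
  exact natDegree_le_of_degree_le hΨdeg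
end Kloo

open Finset
namespace Kloo
open Polynomial

lemma card_sqrts_eq {K : Type*} [Field K] [Fintype K] [DecidableEq K] (hK : ringChar K ≠ 2) (a : K) :
    ((univ.filter (fun z : K => z ^ 2 = a)).card : ℤ) = quadraticChar K a + 1 := by
  rw [← quadraticChar_card_sqrts hK a]
  congr 2
  ext; simp

lemma card_pairs {K : Type*} [Fintype K] [DecidableEq K] (P : K → K → Prop) [∀ x y, Decidable (P x y)] :
    (univ.filter (fun x : K × K => P x.1 x.2)).card = ∑ x, (univ.filter (fun y => P x y)).card := by
  simp only [card_filter, Fintype.sum_prod_type]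

lemma charsum_lower {K : Type*} [Field K] [Fintype K] [DecidableEq K] (p e q : ℕ) [Fact p.Prime]
    [CharP K p] (hp : p ≠ 2) (hcard : Fintype.card K = (p ^ e) ^ 2) (hq : 2 ≤ q)
    (hR : q ^ 2 < p ^ e) (γ : K) (hγ : γ ≠ 0) :
    -(((2 * q - 1 : ℕ) : ℤ) * ((p ^ e : ℕ) : ℤ)) ≤
      ∑ w : K, quadraticChar K ((1 - w ^ (q - 1)) * (1 - w ^ (q - 1) + 4 * γ * w ^ q)) := by
  have hK : ringChar K ≠ 2 := by rw [ringChar.eq K p]; exact hp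
  have h2 : (2 : K) ≠ 0 := Ring.two_ne_zero hK
  obtain ⟨η, hη⟩ := quadraticChar_exists_neg_one hK
  have hη0 : η ≠ 0 := by rintro rfl; simp at hη
  let h : K[X] := C η * ((1 - X ^ (q - 1)) * (1 - X ^ (q - 1) + C (4 * γ) * X ^ q))
  have h4 : (4 * γ : K) ≠ 0 := by
    refine mul_ne_zero ?_ hγ
    have : (4 : K) = 2 * 2 := by norm_num
    rw [this]; exact mul_ne_zero h2 h2
  have d1 : (1 - X ^ (q - 1) : K[X]).natDegree = q - 1 := by
    have : (1 - X ^ (q - 1) : K[X]) = -(X ^ (q - 1) - C 1) := by simp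
    rw [this, natDegree_neg, natDegree_X_pow_sub_C]
  have d2 : (1 - X ^ (q - 1) + C (4 * γ) * X ^ q : K[X]).natDegree = q := by
    have d3 : (C (4 * γ) * X ^ q : K[X]).natDegree = q := natDegree_C_mul_X_pow q _ h4
    rw [natDegree_add_eq_right_of_natDegree_lt, d3]
    rw [d1, d3]; omega
  have hdeg : h.natDegree = 2 * (q - 1) + 1 := by
    simp only [h]
    rw [natDegree_C_mul hη0, natDegree_mul, d1, d2]
    · omega
    · intro h0; rw [h0] at d1; simp at d1; omega
    · intro h0; rw [h0] at d2; simp at d2; omega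
  have hb := bombieri p e (q - 1) hp hcard h hdeg (by
    have : q - 1 + 1 = q := by omega
    rw [this]; exact hR)
  rw [card_pairs (fun x z : K => z ^ 2 = h.eval x)] at hb
  have hb' : (∑ x : K, (quadraticChar K (h.eval x) + 1)) ≤
      (((p ^ e) ^ 2 + (2 * (q - 1) + 1) * p ^ e : ℕ) : ℤ) := by
    simp only [← card_sqrts_eq hK]
    exact_mod_cast hb
  rw [sum_add_distrib] at hb'
  have e1 : ∀ x : K, quadraticChar K (h.eval x) =
     - quadraticChar K ((1 - x ^ (q - 1)) * (1 - x ^ (q - 1) + 4 * γ * x ^ q)) := by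
    intro x
    simp only [h, eval_mul, eval_C, eval_add, eval_sub, eval_one, eval_pow, eval_X, map_mul, hη]
    ring
  simp only [e1, sum_neg_distrib, sum_const, card_univ, hcard] at hb'
  have : 2 * q - 1 = 2 * (q - 1) + 1 := by omega
  rw [this]
  push_cast at hb' ⊢
  simp only [nsmul_eq_mul, mul_one] at hb'
  push_cast at hb'
  linarith

lemma trace_count {F K : Type*} [Field F] [Fintype F] [Field K] [Fintype K] [DecidableEq K] [DecidableEq F]
    [Algebra F K] (p q j : ℕ) [Fact p.Prime] [CharP F p] [CharP K p] (hp : p ≠ 2)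
    (hq : Fintype.card F = q) (hm : Module.finrank F K = 2 * (p * j))
    (hR : q ^ 2 < q ^ (p * j)) (a b : F) (ha : a ≠ 0) (hb : b ≠ 0) :
    ((q ^ (p * j)) ^ 2 : ℤ) - 1 - (2 * q - 1) * q ^ (p * j) ≤
      q * (univ.filter (fun x : K => x ≠ 0 ∧
        Algebra.trace F K (algebraMap F K a * x + algebraMap F K b * x⁻¹) = 0)).card := by
  have hK : ringChar K ≠ 2 := by rw [ringChar.eq K p]; exact hp
  have h2 : (2 : K) ≠ 0 := Ring.two_ne_zero hK
  have hq2 : 2 ≤ q := hq ▸ Fintype.one_lt_card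
  set R := q ^ (p * j) with hRd
  have hcardK : Fintype.card K = R ^ 2 := by
    rw [Module.card_eq_pow_finrank (K := F), hq, hm, hRd, ← pow_mul]; congr 1; ring
  obtain ⟨f, -, hf⟩ := FiniteField.card F p
  have hRp : R = p ^ ((f : ℕ) * (p * j)) := by rw [hRd, ← hq, hf, ← pow_mul]
  have hRodd : Odd R := by rw [hRp]; exact (Nat.Prime.odd_of_ne_two Fact.out hp).pow
  set a' := algebraMap F K a with ha'
  set b' := algebraMap F K b with hb'
  have ha0 : a' ≠ 0 := by simpa [ha'] using ha
  have hb0 : b' ≠ 0 := by simpa [hb'] using hb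
  have hcR : ∀ c : F, (algebraMap F K c) ^ R = algebraMap F K c := by
    intro c; rw [← map_pow, hRd, ← hq, FiniteField.pow_card_pow]
  have hsq : IsSquare (a' * b') := by
    rw [FiniteField.isSquare_iff hK (mul_ne_zero ha0 hb0), hcardK]
    obtain ⟨k, hk⟩ := hRodd
    have h1 : R ^ 2 / 2 = (R - 1) * (k + 1) := by
      have : R ^ 2 = 2 * (2 * k * (k + 1)) + 1 := by rw [hk]; ring
      rw [this, hk]
      have : 2 * k + 1 - 1 = 2 * k := by omega
      rw [this]; omega
    rw [h1, pow_mul]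
    have h3 : (a' * b') ^ (R - 1) = 1 := by
      have h4 := hcR (a * b)
      rw [map_mul] at h4
      have h5 : R = R - 1 + 1 := by omega
      rw [h5, pow_succ] at h4
      exact (mul_eq_right₀ (mul_ne_zero ha0 hb0)).1 h4
    rw [h3, one_pow]
  obtain ⟨γ, hγ⟩ := hsq
  have hγ0 : γ ≠ 0 := by rintro rfl; simp [ha0, hb0] at hγ
  have hγq : γ ^ q = γ ∨ γ ^ q = -γ := by
    apply sq_eq_sq_iff_eq_or_eq_neg.1
    rw [← pow_mul, mul_comm, pow_mul, sq, ← hγ, ← map_mul, ← map_pow, ← hq, FiniteField.pow_card]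
  have hcF : Nat.card F = q := by rw [Nat.card_eq_fintype_card, hq]
  have hqodd : Odd q := by rw [← hq, hf]; exact (Nat.Prime.odd_of_ne_two Fact.out hp).pow
  have htrγ : Algebra.trace F K γ = 0 := by
    apply (algebraMap F K).injective
    rw [FiniteField.algebraMap_trace_eq_sum_pow, hm, hcF, map_zero]
    rcases hγq with h | h
    · have : ∀ i, γ ^ q ^ i = γ := by
        intro i; induction i with
        | zero => simp
        | succ i ih => rw [pow_succ, pow_mul, ih, h]
      simp [this]
    · have : ∀ i, γ ^ q ^ i = (-1) ^ i * γ := by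
        intro i; induction i with
        | zero => simp
        | succ i ih => rw [pow_succ, pow_mul, ih, mul_pow, h, ← pow_mul, mul_comm i q, pow_mul, hqodd.neg_one_pow]; ring
      simp only [this, ← sum_mul]
      rw [neg_one_geom_sum]
      simp
  have htrq : ∀ y : K, Algebra.trace F K (y ^ q) = Algebra.trace F K y := by
    intro y
    have := Algebra.trace_eq_of_algEquiv (FiniteField.frobeniusAlgEquivOfAlgebraic F K) y
    rw [FiniteField.coe_frobeniusAlgEquivOfAlgebraic, hq] at this
    exact this
  -- pairs
  set T := univ.filter (fun x : K => x ≠ 0 ∧ Algebra.trace F K (a' * x + b' * x⁻¹) = 0) with hT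
  let P := univ.filter (fun s : K × K => s.2 ≠ 0 ∧ a' * s.2 + b' * s.2⁻¹ = 2 * γ + (s.1 ^ q - s.1))
  have hPle : P.card ≤ q * T.card := by
    have hmaps : ∀ s ∈ P, s.2 ∈ T := by
      rintro ⟨y, x⟩ hs
      simp only [P, mem_filter, mem_univ, true_and] at hs
      simp only [hT, mem_filter, mem_univ, true_and]
      refine ⟨hs.1, ?_⟩
      rw [hs.2, map_add, map_sub, htrq, sub_self, add_zero, two_mul, map_add, htrγ, add_zero]
    refine card_le_mul_card_image_of_maps_to hmaps q ?_
    intro x hx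
    let rp : K[X] := X ^ q - X - C (a' * x + b' * x⁻¹ - 2 * γ)
    have hrd : rp.natDegree = q := by
      have : rp = X ^ q - (X + C (a' * x + b' * x⁻¹ - 2 * γ)) := by simp only [rp]; ring
      rw [this, natDegree_sub_eq_left_of_natDegree_lt, natDegree_X_pow]
      rw [natDegree_X_add_C, natDegree_X_pow]; omega
    have hr0 : rp ≠ 0 := by intro h; rw [h] at hrd; simp at hrd; omega
    calc _ ≤ rp.roots.toFinset.card := by
          apply card_le_card_of_injOn (fun s => s.1)
          · rintro ⟨y, x'⟩ hs
            simp only [P, coe_filter, mem_filter, mem_univ, true_and, Set.mem_setOf_eq] at hs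
            obtain ⟨⟨h1, h3⟩, rfl⟩ := hs
            simp only [mem_coe, Multiset.mem_toFinset, mem_roots hr0, IsRoot.def, rp, eval_sub, eval_pow, eval_X, eval_C]
            linear_combination -h3
          · rintro ⟨y, x'⟩ hs ⟨y', x''⟩ hs' h
            simp only [coe_filter, mem_filter, Set.mem_setOf_eq] at hs hs'
            simp only at h
            rw [h, hs.2, hs'.2]
      _ ≤ rp.roots.card := Multiset.toFinset_card_le _
      _ ≤ q := hrd ▸ card_roots' rp
  have hPeq : (P.card : ℤ) = ∑ y : K, (quadraticChar K ((y ^ q - y) * (y ^ q - y + 4 * γ)) + 1) := by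
    have : P.card = ∑ y : K, (univ.filter (fun x : K => x ≠ 0 ∧ a' * x + b' * x⁻¹ = 2 * γ + (y ^ q - y))).card :=
      card_pairs (fun y x : K => x ≠ 0 ∧ a' * x + b' * x⁻¹ = 2 * γ + (y ^ q - y))
    rw [this]; push_cast
    refine sum_congr rfl fun y _ => ?_
    rw [← card_sqrts_eq hK]
    norm_cast
    set v := 2 * γ + (y ^ q - y) with hv
    have hdisc : (y ^ q - y) * (y ^ q - y + 4 * γ) = v ^ 2 - 4 * (a' * b') := by rw [hγ, hv]; ring
    rw [hdisc]
    refine card_bij (fun x _ => 2 * a' * x - v) ?_ ?_ ?_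
    · intro x hx
      simp only [mem_filter, mem_univ, true_and] at hx ⊢
      obtain ⟨h1, h3⟩ := hx
      rw [← h3]; field_simp; ring
    · intro x _ x' _ h
      have : 2 * a' * x = 2 * a' * x' := by linear_combination h
      exact mul_left_cancel₀ (mul_ne_zero h2 ha0) this
    · intro s hs
      simp only [mem_filter, mem_univ, true_and] at hs
      have hquad : a' * ((s + v) / (2 * a')) ^ 2 - v * ((s + v) / (2 * a')) + b' = 0 := by
        field_simp
        linear_combination hs
      have hx0 : (s + v) / (2 * a') ≠ 0 := by
        intro h; rw [h] at hquad; simp at hquad; exact hb0 hquad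
      refine ⟨(s + v) / (2 * a'), ?_, ?_⟩
      · simp only [mem_filter, mem_univ, true_and]
        refine ⟨hx0, ?_⟩
        have : a' * ((s + v) / (2 * a')) + b' * ((s + v) / (2 * a'))⁻¹ =
          (a' * ((s + v) / (2 * a')) ^ 2 + b') * ((s + v) / (2 * a'))⁻¹ := by
          generalize (s + v) / (2 * a') = x at hx0
          field_simp
        rw [this, mul_inv_eq_iff_eq_mul₀ hx0]
        linear_combination hquad
      · field_simp; ring
  have hinv : ∑ y : K, quadraticChar K ((y ^ q - y) * (y ^ q - y + 4 * γ)) =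
      ∑ w : K, quadraticChar K ((1 - w ^ (q - 1)) * (1 - w ^ (q - 1) + 4 * γ * w ^ q)) - 1 := by
    rw [← add_sum_erase univ _ (mem_univ (0 : K)),
      ← add_sum_erase univ (fun w : K => quadraticChar K ((1 - w ^ (q - 1)) * (1 - w ^ (q - 1) + 4 * γ * w ^ q))) (mem_univ (0 : K))]
    have z1 : q ≠ 0 := by omega
    have z2 : q - 1 ≠ 0 := by omega
    simp only [zero_pow z1, zero_pow z2, sub_zero, mul_zero, zero_mul, add_zero, mul_one, map_one, MulChar.map_zero, zero_add]
    rw [add_sub_cancel_left]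
    refine sum_bij (fun y _ => y⁻¹) ?_ ?_ ?_ ?_
    · intro y hy; simpa using hy
    · intro y _ y' _ h; exact inv_injective h
    · intro w hw; exact ⟨w⁻¹, by simpa using hw, inv_inv w⟩
    · intro y hy
      have hy0 : y ≠ 0 := (mem_erase.1 hy).1
      have : (1 - y⁻¹ ^ (q - 1)) * (1 - y⁻¹ ^ (q - 1) + 4 * γ * y⁻¹ ^ q) =
          (y⁻¹ ^ q) ^ 2 * ((y ^ q - y) * (y ^ q - y + 4 * γ)) := by
        obtain ⟨k, rfl⟩ : ∃ k, q = k + 1 := ⟨q - 1, by omega⟩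
        simp only [Nat.add_sub_cancel]
        have : y⁻¹ ^ k = y * y⁻¹ ^ (k + 1) := by rw [pow_succ]; field_simp
        rw [this]
        have h1 : y⁻¹ ^ (k + 1) * y ^ (k + 1) = 1 := by rw [← mul_pow, inv_mul_cancel₀ hy0, one_pow]
        generalize y⁻¹ ^ (k + 1) = t at *
        generalize y ^ (k + 1) = s at *
        linear_combination (-1 - t * s + 2 * t * y - 4 * γ * t) * h1
      rw [this, map_mul (quadraticChar K) ((y⁻¹ ^ q) ^ 2), quadraticChar_sq_one' (pow_ne_zero _ (inv_ne_zero hy0)), one_mul]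
  have hlow := charsum_lower p ((f : ℕ) * (p * j)) q hp (by rw [hcardK, hRp]) hq2 (by rw [← hRp]; exact hR) γ hγ0
  rw [← hRp] at hlow
  rw [sum_add_distrib, hinv] at hPeq
  simp only [sum_const, card_univ, hcardK, nsmul_eq_mul, mul_one] at hPeq
  have hPle' : (P.card : ℤ) ≤ q * T.card := by exact_mod_cast hPle
  have hc : ((2 * q - 1 : ℕ) : ℤ) = 2 * q - 1 := by push_cast [show 1 ≤ 2 * q by omega]; ring
  rw [hc] at hlow
  have hRc : (R : ℤ) = (q : ℤ) ^ (p * j) := by rw [hRd]; push_cast; rfl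
  push_cast at hPeq hlow ⊢
  rw [hRc] at hlow hPeq
  linarith
end Kloo

open Finset
namespace Kloo
open Polynomial

/-- number of elements with a given minimal polynomial -/
lemma card_minpoly_eq {F K : Type*} [Field F] [Fintype F] [Field K] [Fintype K] [DecidableEq K]
    [DecidableEq F[X]] [Algebra F K] (P : F[X]) (hP : P.Monic) (hi : Irreducible P) :
    (univ.filter (fun x : K => minpoly F x = P)).card =
      if P.natDegree ∣ Module.finrank F K then P.natDegree else 0 := by
  split_ifs with hd
  · have hdv := (hi.natDegree_dvd_iff_dvd_X_pow_card_pow_sub_X).1 hd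
    rw [← Module.natCard_eq_pow_finrank] at hdv
    have hcK : 1 < Nat.card K := Finite.one_lt_card
    have hsp : (P.map (algebraMap F K)).Splits := by
      have h1 := Polynomial.splits_X_pow_nat_card_sub_X (K := K)
      refine h1.of_dvd ?_ ?_
      · exact FiniteField.X_pow_card_sub_X_ne_zero K hcK
      · have := Polynomial.map_dvd (algebraMap F K) hdv
        simpa using this
    have hsep : P.Separable := (PerfectField.separable_of_irreducible hi)
    have hnd : (P.map (algebraMap F K)).roots.Nodup := nodup_roots hsep.map
    have h2 := hsp.natDegree_eq_card_roots
    rw [natDegree_map] at h2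
    rw [h2, ← Multiset.toFinset_card_of_nodup hnd]
    congr 1
    ext x
    have hne : P.map (algebraMap F K) ≠ 0 := (hP.map _).ne_zero
    simp only [mem_filter, mem_univ, true_and, Multiset.mem_toFinset, mem_roots hne, IsRoot.def]
    constructor
    · rintro rfl; simp
    · intro h
      exact (minpoly.eq_of_irreducible_of_monic hi (by simpa [aeval_def] using h) hP).symm
  · rw [card_eq_zero, filter_eq_empty_iff]
    rintro x - rfl
    exact hd (minpoly.degree_dvd (.of_finite F x))

open Classical in
/-- The multiplicative function attached to the Kloosterman sum. -/
noncomputable def Lam {F : Type*} [Field F] (ψ : AddChar F ℂ) (a b : F) (h : F[X]) : ℂ :=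
  if h.coeff 0 = 0 then 0 else ψ (-(a * h.nextCoeff) - b * (h.coeff 1 / h.coeff 0))

lemma Lam_mul {F : Type*} [Field F] (ψ : AddChar F ℂ) (a b : F) {g h : F[X]} (hg : g.Monic) (hh : h.Monic) :
    Lam ψ a b (g * h) = Lam ψ a b g * Lam ψ a b h := by
  unfold Lam
  rw [mul_coeff_zero]
  by_cases h1 : g.coeff 0 = 0
  · simp [h1]
  by_cases h2 : h.coeff 0 = 0
  · simp [h2]
  rw [if_neg (mul_ne_zero h1 h2), if_neg h1, if_neg h2, hg.nextCoeff_mul hh, ← AddChar.map_add_eq_mul, mul_coeff_one]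
  congr 1
  field_simp
  ring

lemma Lam_one {F : Type*} [Field F] (ψ : AddChar F ℂ) (a b : F) : Lam ψ a b 1 = 1 := by
  simp [Lam, nextCoeff, coeff_one]

lemma Lam_pow {F : Type*} [Field F] (ψ : AddChar F ℂ) (a b : F) {g : F[X]} (hg : g.Monic) (n : ℕ) :
    Lam ψ a b (g ^ n) = Lam ψ a b g ^ n := by
  induction n with
  | zero => simp [Lam_one]
  | succ n ih => rw [pow_succ, Lam_mul ψ a b (hg.pow n) hg, ih, pow_succ]

lemma minpoly_inv_nextCoeff {F K : Type*} [Field F] [Field K] [Algebra F K] [FiniteDimensional F K]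
    (x : K) (hx : x ≠ 0) :
    (minpoly F x⁻¹).nextCoeff = (minpoly F x).coeff 1 / (minpoly F x).coeff 0 := by
  have hi : IsIntegral F x := .of_finite F x
  have hi' : IsIntegral F x⁻¹ := .of_finite F x⁻¹
  have h0 : (minpoly F x).coeff 0 ≠ 0 := minpoly.coeff_zero_ne_zero hi hx
  have hadj : IntermediateField.adjoin F {x⁻¹} = IntermediateField.adjoin F {x} := by
    apply le_antisymm
    · rw [IntermediateField.adjoin_simple_le_iff]
      exact inv_mem (IntermediateField.mem_adjoin_simple_self F x)
    · rw [IntermediateField.adjoin_simple_le_iff]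
      have := inv_mem (IntermediateField.mem_adjoin_simple_self F x⁻¹)
      simpa using this
  have hdeg : (minpoly F x⁻¹).natDegree = (minpoly F x).natDegree := by
    rw [← IntermediateField.adjoin.finrank hi, ← IntermediateField.adjoin.finrank hi', hadj]
  have hpos : 0 < (minpoly F x).natDegree := minpoly.natDegree_pos hi
  set P := minpoly F x with hP
  have hPm : P.Monic := minpoly.monic hi
  have hrd : P.reverse.natDegree = P.natDegree := by
    rw [reverse_natDegree, natTrailingDegree_eq_zero_of_constantCoeff_ne_zero (by simpa using h0)]; simp
  have hrl : P.reverse.leadingCoeff = P.coeff 0 := by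
    rw [leadingCoeff, hrd, coeff_reverse, revAt_le le_rfl, Nat.sub_self]
  set R := P.reverse * C (P.coeff 0)⁻¹ with hR
  have hRm : R.Monic := by
    rw [hR, ← hrl]; exact monic_mul_leadingCoeff_inv (by rw [← leadingCoeff_ne_zero, hrl]; exact h0)
  have hRd : R.natDegree = P.natDegree := by
    rw [hR, natDegree_mul_C (inv_ne_zero h0), hrd]
  have hroot : aeval x⁻¹ R = 0 := by
    rw [hR, map_mul]
    have : aeval x⁻¹ P.reverse = 0 := by
      let := invertibleOfNonzero hx
      have := (eval₂_reverse_eq_zero_iff (algebraMap F K) x P).2 (by rw [← aeval_def]; exact minpoly.aeval F x)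
      rwa [invOf_eq_inv] at this
    rw [this, zero_mul]
  have hdvd : minpoly F x⁻¹ ∣ R := minpoly.dvd F _ hroot
  have heq : minpoly F x⁻¹ = R := by
    symm
    exact eq_of_monic_of_dvd_of_natDegree_le (minpoly.monic hi') hRm hdvd (by rw [hRd, hdeg])
  rw [heq, nextCoeff_of_natDegree_pos (by omega), hRd, hR, coeff_mul_C, coeff_reverse, revAt_le (by omega), div_eq_mul_inv]
  congr 2
  omega

lemma Lam_minpoly {F K : Type*} [Field F] [Field K] [Algebra F K] [FiniteDimensional F K] [DecidableEq K]
    (ψ : AddChar F ℂ) (a b : F) (x : K) :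
    Lam ψ a b (minpoly F x ^ (Module.finrank F K / (minpoly F x).natDegree)) =
      if x = 0 then 0 else ψ (Algebra.trace F K (algebraMap F K a * x + algebraMap F K b * x⁻¹)) := by
  have hi : IsIntegral F x := .of_finite F x
  have hi' : IsIntegral F x⁻¹ := .of_finite F x⁻¹
  have hadj : IntermediateField.adjoin F {x⁻¹} = IntermediateField.adjoin F {x} := by
    apply le_antisymm
    · rw [IntermediateField.adjoin_simple_le_iff]
      exact inv_mem (IntermediateField.mem_adjoin_simple_self F x)
    · rw [IntermediateField.adjoin_simple_le_iff]
      have := inv_mem (IntermediateField.mem_adjoin_simple_self F x⁻¹)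
      simpa using this
  have hfin : Module.finrank F K = (minpoly F x).natDegree * Module.finrank (IntermediateField.adjoin F {x}) K := by
    rw [← IntermediateField.adjoin.finrank hi, Module.finrank_mul_finrank]
  have hpos : 0 < (minpoly F x).natDegree := minpoly.natDegree_pos hi
  have hq : Module.finrank F K / (minpoly F x).natDegree = Module.finrank (IntermediateField.adjoin F {x}) K := by
    rw [hfin, Nat.mul_div_cancel_left _ hpos]
  rw [hq, Lam_pow _ _ _ (minpoly.monic hi)]
  split_ifs with h0
  · subst h0
    rw [Lam, if_pos (by simp [minpoly.zero]), zero_pow]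
    exact Module.finrank_pos.ne'
  · rw [Lam, if_neg (minpoly.coeff_zero_ne_zero hi h0), ← AddChar.map_nsmul_eq_pow]
    congr 1
    rw [map_add, ← Algebra.smul_def, ← Algebra.smul_def, map_smul, map_smul,
      trace_eq_finrank_mul_minpoly_nextCoeff, trace_eq_finrank_mul_minpoly_nextCoeff,
      minpoly_inv_nextCoeff x h0, hadj]
    simp only [nsmul_eq_mul, smul_eq_mul]
    ring

open Classical in
/-- monic polynomials of degree n -/
noncomputable def mon (F : Type*) [Field F] [Fintype F] (n : ℕ) : Finset F[X] :=
  univ.image (fun c : Fin n → F => X ^ n + ∑ i : Fin n, C (c i) * X ^ (i : ℕ))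

lemma mem_mon {F : Type*} [Field F] [Fintype F] (n : ℕ) (h : F[X]) :
    h ∈ mon F n ↔ h.Monic ∧ h.natDegree = n := by
  classical
  unfold mon
  simp only [mem_image, mem_univ, true_and]
  constructor
  · rintro ⟨c, rfl⟩
    have hlt := degree_sum_fin_lt c
    refine ⟨monic_X_pow_add hlt, ?_⟩
    rw [natDegree_eq_of_degree_eq_some]
    rw [degree_add_eq_left_of_degree_lt (by rwa [degree_X_pow]), degree_X_pow]
  · rintro ⟨hm, hd⟩
    refine ⟨fun i => h.coeff i, ?_⟩
    conv_rhs => rw [hm.as_sum, hd]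
    rw [Finset.sum_range]

lemma sum_mon_dvd {F : Type*} [Field F] [Fintype F] [DecidableEq F[X]] (ψ : AddChar F ℂ) (a b : F) (n j : ℕ) (hj : j ≤ n)
    (G : F[X]) (hG : G.Monic) (hd : G.natDegree = j) [DecidablePred (fun h : F[X] => G ∣ h)] :
    ∑ h ∈ (mon F n).filter (fun h => G ∣ h), Lam ψ a b h = Lam ψ a b G * ∑ g ∈ mon F (n - j), Lam ψ a b g := by
  rw [mul_sum]
  symm
  refine sum_bij (fun g _ => G * g) ?_ ?_ ?_ ?_
  · intro g hg
    rw [mem_mon] at hg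
    rw [mem_filter, mem_mon]
    refine ⟨⟨hG.mul hg.1, ?_⟩, dvd_mul_right _ _⟩
    rw [hG.natDegree_mul hg.1]; omega
  · intro g _ g' _ h
    exact mul_left_cancel₀ hG.ne_zero h
  · intro h hh
    rw [mem_filter, mem_mon] at hh
    obtain ⟨⟨hm, hdeg⟩, g, rfl⟩ := hh
    have hg : g.Monic := hG.of_mul_monic_left hm
    refine ⟨g, ?_, rfl⟩
    rw [mem_mon]
    rw [hG.natDegree_mul hg] at hdeg
    exact ⟨hg, by omega⟩
  · intro g hg
    rw [mem_mon] at hg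
    rw [Lam_mul _ _ _ hG hg.1]

lemma count_mult (d c n : ℕ) (hd : 0 < d) (hc : c * d ≤ n) :
    ((range n).filter (fun j => d ∣ j + 1 ∧ (j + 1) / d ≤ c)).card = c := by
  conv_rhs => rw [← card_range c]
  symm
  refine card_bij (fun e _ => (e + 1) * d - 1) ?_ ?_ ?_
  · intro e he
    rw [mem_range] at he
    have h1 : (e + 1) * d ≤ c * d := Nat.mul_le_mul_right _ he
    have h2 : 0 < (e + 1) * d := by positivity
    have h3 : (e + 1) * d - 1 + 1 = (e + 1) * d := by omega
    rw [mem_filter, mem_range, h3]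
    refine ⟨by omega, dvd_mul_left _ _, ?_⟩
    rw [Nat.mul_div_cancel _ hd]; exact he
  · intro e _ e' _ h
    have h2 : 0 < (e + 1) * d := by positivity
    have h2' : 0 < (e' + 1) * d := by positivity
    have : (e + 1) * d = (e' + 1) * d := by omega
    have := Nat.eq_of_mul_eq_mul_right hd this
    omega
  · intro j hj
    rw [mem_filter] at hj
    obtain ⟨-, ⟨k, hk⟩, h⟩ := hj
    rw [hk, Nat.mul_div_cancel_left _ hd] at h
    have hk0 : k ≠ 0 := by rintro rfl; simp at hk
    refine ⟨k - 1, mem_range.2 (by omega), ?_⟩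
    have : k - 1 + 1 = k := by omega
    simp only [this]
    rw [mul_comm, ← hk]; omega

noncomputable instance extFintype (F : Type*) [Field F] [Finite F] (p : ℕ) [Fact p.Prime] [CharP F p] (n : ℕ) [NeZero n] :
    Fintype (FiniteField.Extension F p n) := Fintype.ofFinite _

open Classical UniqueFactorizationMonoid in
lemma deg_count {F : Type*} [Field F] [Fintype F] (p : ℕ) [Fact p.Prime] [CharP F p] (h : F[X]) (hm : h.Monic) :
    ∑ j ∈ range h.natDegree, (univ.filter (fun x : FiniteField.Extension F p (j + 1) =>
      minpoly F x ^ ((j + 1) / (minpoly F x).natDegree) ∣ h)).card = h.natDegree := by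
  set T := (normalizedFactors h).toFinset with hT
  have hTm : ∀ P, P ∈ T ↔ Irreducible P ∧ P.Monic ∧ P ∣ h := by
    intro P
    rw [hT, Multiset.mem_toFinset, mem_normalizedFactors_iff' hm.ne_zero]
    constructor
    · rintro ⟨h1, h2, h3⟩
      refine ⟨h1, ?_, h3⟩
      rw [← h2]; exact monic_normalize h1.ne_zero
    · rintro ⟨h1, h2, h3⟩
      exact ⟨h1, h2.normalize_eq_self, h3⟩
  have hpd : ∀ P ∈ T, ∀ e, P ^ e ∣ h ↔ e ≤ (normalizedFactors h).count P := by
    intro P hP e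
    rw [hTm] at hP
    rw [pow_dvd_iff_le_emultiplicity, emultiplicity_eq_count_normalizedFactors hP.1 hm.ne_zero,
      hP.2.1.normalize_eq_self]
    norm_cast
  have hprod : (normalizedFactors h).prod = h := by
    have h1 := prod_normalizedFactors hm.ne_zero
    refine eq_of_monic_of_associated ?_ hm h1
    apply monic_multiset_prod_of_monic _ id ?_ |> fun h => by simpa using h
    intro P hP
    exact ((hTm P).1 (Multiset.mem_toFinset.2 hP)).2.1
  have hdeg : ∑ P ∈ T, (normalizedFactors h).count P * P.natDegree = h.natDegree := by
    conv_rhs => rw [← hprod]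
    rw [natDegree_multiset_prod_of_monic, Finset.sum_multiset_map_count]
    · simp [hT]
    · intro P hP
      exact ((hTm P).1 (Multiset.mem_toFinset.2 hP)).2.1
  have hfib : ∀ j ∈ range h.natDegree, (univ.filter (fun x : FiniteField.Extension F p (j + 1) =>
      minpoly F x ^ ((j + 1) / (minpoly F x).natDegree) ∣ h)).card =
      ∑ P ∈ T, if P.natDegree ∣ j + 1 ∧ (j + 1) / P.natDegree ≤ (normalizedFactors h).count P then P.natDegree else 0 := by
    intro j _
    rw [card_eq_sum_card_fiberwise (f := fun x => minpoly F x) (t := T)]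
    · refine sum_congr rfl fun P hP => ?_
      have hP' := (hTm P).1 hP
      rw [filter_filter]
      have hcm := card_minpoly_eq (K := FiniteField.Extension F p (j + 1)) P hP'.2.1 hP'.1
      rw [FiniteField.finrank_extension] at hcm
      by_cases hc : (j + 1) / P.natDegree ≤ (normalizedFactors h).count P
      · simp only [hc, and_true]
        rw [← hcm]
        congr 1
        ext x
        simp only [mem_filter, mem_univ, true_and]
        constructor
        · exact fun h => h.2
        · rintro rfl
          exact ⟨(hpd _ hP _).2 hc, rfl⟩
      · simp only [hc, and_false, if_false]
        rw [card_eq_zero, filter_eq_empty_iff]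
        rintro x - ⟨h1, rfl⟩
        exact hc ((hpd _ hP _).1 h1)
    · intro x hx
      simp only [coe_filter, mem_univ, true_and] at hx
      rw [mem_coe, hTm]
      have hi : IsIntegral F x := .of_finite F x
      refine ⟨minpoly.irreducible hi, minpoly.monic hi, ?_⟩
      refine (dvd_pow_self _ ?_).trans hx
      have hd := minpoly.degree_dvd hi
      rw [FiniteField.finrank_extension] at hd
      exact (Nat.div_pos (Nat.le_of_dvd (by omega) hd) (minpoly.natDegree_pos hi)).ne'
  rw [sum_congr rfl hfib, sum_comm]
  conv_rhs => rw [← hdeg]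
  refine sum_congr rfl fun P hP => ?_
  have hP' := (hTm P).1 hP
  rw [← sum_filter, sum_const, smul_eq_mul, count_mult _ _ _ hP'.1.natDegree_pos]
  have := natDegree_le_of_dvd ((hpd P hP _).2 le_rfl) hm.ne_zero
  rwa [natDegree_pow] at this

open Classical in
/-- Kloosterman sums over extensions -/
noncomputable def KS (F K : Type*) [Field F] [Field K] [Fintype K] [Algebra F K] (ψ : AddChar F ℂ) (a b : F) : ℂ :=
  ∑ x : K, if x = 0 then 0 else ψ (Algebra.trace F K (algebraMap F K a * x + algebraMap F K b * x⁻¹))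

noncomputable def LS (F : Type*) [Field F] [Fintype F] (ψ : AddChar F ℂ) (a b : F) (n : ℕ) : ℂ :=
  ∑ h ∈ mon F n, Lam ψ a b h

lemma LS_rec (F : Type*) [Field F] [Fintype F] (p : ℕ) [Fact p.Prime] [CharP F p] (ψ : AddChar F ℂ) (a b : F) (n : ℕ) :
    n * LS F ψ a b n = ∑ j ∈ range n, KS F (FiniteField.Extension F p (j + 1)) ψ a b * LS F ψ a b (n - (j + 1)) := by
  classical
  have h1 : n * LS F ψ a b n = ∑ h ∈ mon F n, ∑ j ∈ range n, ∑ x : FiniteField.Extension F p (j + 1),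
      if minpoly F x ^ ((j + 1) / (minpoly F x).natDegree) ∣ h then Lam ψ a b h else 0 := by
    rw [LS, mul_sum]
    refine sum_congr rfl fun h hh => ?_
    rw [mem_mon] at hh
    have := deg_count p h hh.1
    rw [hh.2] at this
    conv_lhs => rw [← this]
    rw [Nat.cast_sum, sum_mul]
    refine sum_congr rfl fun j _ => ?_
    rw [← sum_filter, sum_const, nsmul_eq_mul]
  rw [h1, sum_comm]
  refine sum_congr rfl fun j hj => ?_
  rw [sum_comm, KS, sum_mul]
  refine sum_congr rfl fun x _ => ?_
  have hi : IsIntegral F x := .of_finite F x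
  have hd := minpoly.degree_dvd hi
  rw [FiniteField.finrank_extension] at hd
  have hlm := Lam_minpoly ψ a b x
  rw [FiniteField.finrank_extension] at hlm
  rw [← hlm, ← sum_filter, LS]
  rw [sum_mon_dvd ψ a b n (j + 1) (by rw [mem_range] at hj; omega) _ ((minpoly.monic hi).pow _)]
  rw [natDegree_pow, Nat.div_mul_cancel hd]

lemma LS_zero (F : Type*) [Field F] [Fintype F] (ψ : AddChar F ℂ) (a b : F) : LS F ψ a b 0 = 1 := by
  have : mon F 0 = {1} := by
    ext h
    rw [mem_mon, mem_singleton]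
    constructor
    · rintro ⟨h1, h2⟩; exact h1.natDegree_eq_zero.1 h2
    · rintro rfl; exact ⟨monic_one, natDegree_one⟩
  rw [LS, this, sum_singleton, Lam_one]

open Classical in
/-- the classical Kloosterman sum -/
noncomputable def KL (F : Type*) [Field F] [Fintype F] (ψ : AddChar F ℂ) (a b : F) : ℂ :=
  ∑ x : F, if x = 0 then 0 else ψ (a * x + b * x⁻¹)

open Classical in
lemma KL_eq_sum_neg (F : Type*) [Field F] [Fintype F] (ψ : AddChar F ℂ) (a b : F) :
    KL F ψ a b = ∑ x : F, if x = 0 then 0 else ψ (-(a * x) - b * (1 / x)) := by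
  classical
  rw [KL]
  refine Fintype.sum_equiv (Equiv.neg F) _ _ fun x => ?_
  simp only [Equiv.neg_apply, neg_eq_zero]
  split_ifs with h
  · rfl
  · congr 1; rw [inv_eq_one_div, one_div_neg_eq_neg_one_div]; ring

lemma LS_one (F : Type*) [Field F] [Fintype F] (ψ : AddChar F ℂ) (a b : F) : LS F ψ a b 1 = KL F ψ a b := by
  classical
  rw [KL_eq_sum_neg, LS]
  symm
  refine sum_bij (fun c _ => X + C c) ?_ ?_ ?_ ?_
  · intro c _
    rw [mem_mon]; exact ⟨monic_X_add_C c, natDegree_X_add_C c⟩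
  · intro c _ c' _ h
    exact C_injective (add_left_cancel h)
  · intro h hh
    rw [mem_mon] at hh
    refine ⟨h.coeff 0, mem_univ _, ?_⟩
    have h1 := hh.1.as_sum
    rw [hh.2] at h1
    conv_rhs => rw [h1]
    simp
  · intro c _
    unfold Lam
    have : (X + C c : F[X]).coeff 0 = c := by simp
    rw [this]
    split_ifs with h
    · rfl
    · congr 1
      rw [nextCoeff_X_add_C]
      simp [coeff_C]

lemma LS_two (F : Type*) [Field F] [Fintype F] (ψ : AddChar F ℂ) (hψ : ψ.IsPrimitive) (a b : F) (ha : a ≠ 0) (hb : b ≠ 0) :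
    LS F ψ a b 2 = Fintype.card F := by
  classical
  have h1 : LS F ψ a b 2 = ∑ s : F × F, if s.1 = 0 then 0 else ψ (s.2 * (-a - b / s.1)) := by
    rw [LS]
    symm
    refine sum_bij (fun s _ => X ^ 2 + (C s.2 * X + C s.1)) ?_ ?_ ?_ ?_
    · rintro ⟨c0, c1⟩ _
      rw [mem_mon]
      have hd : (C c1 * X + C c0 : F[X]).degree < 2 := lt_of_le_of_lt degree_linear_le (by norm_num)
      refine ⟨monic_X_pow_add hd, ?_⟩
      apply natDegree_eq_of_degree_eq_some
      rw [degree_add_eq_left_of_degree_lt (by rwa [degree_X_pow]), degree_X_pow]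
    · rintro ⟨c0, c1⟩ _ ⟨c0', c1'⟩ _ h
      have e0 := congrArg (fun f => coeff f 0) h
      have e1 := congrArg (fun f => coeff f 1) h
      simp [coeff_X_pow, coeff_C] at e0 e1
      rw [e0, e1]
    · intro h hh
      rw [mem_mon] at hh
      refine ⟨(h.coeff 0, h.coeff 1), mem_univ _, ?_⟩
      have h1 := hh.1.as_sum
      rw [hh.2] at h1
      conv_rhs => rw [h1]
      simp [sum_range_succ, add_comm]
    · rintro ⟨c0, c1⟩ _
      have hd : (C c1 * X + C c0 : F[X]).degree < 2 := lt_of_le_of_lt degree_linear_le (by norm_num)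
      have hnd : (X ^ 2 + (C c1 * X + C c0) : F[X]).natDegree = 2 := by
        apply natDegree_eq_of_degree_eq_some
        rw [degree_add_eq_left_of_degree_lt (by rwa [degree_X_pow]), degree_X_pow]
      unfold Lam
      have e0 : (X ^ 2 + (C c1 * X + C c0) : F[X]).coeff 0 = c0 := by simp
      have e1 : (X ^ 2 + (C c1 * X + C c0) : F[X]).coeff 1 = c1 := by simp [coeff_X_pow, coeff_C]
      rw [nextCoeff_of_natDegree_pos (p := X ^ 2 + (C c1 * X + C c0)) (by omega), hnd, e0, e1]
      split_ifs with h
      · rfl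
      · congr 1; ring
  rw [h1, Fintype.sum_prod_type]
  have h2 : ∀ c : F, (∑ y : F, if c = 0 then 0 else ψ (y * (-a - b / c))) =
      if c = -b / a then (Fintype.card F : ℂ) else 0 := by
    intro c
    by_cases hc : c = 0
    · have : ¬ (0 : F) = -b / a := by
        intro h; exact (div_ne_zero (neg_ne_zero.2 hb) ha) h.symm
      simp [hc, this]
    · simp only [hc, if_false]
      rw [AddChar.sum_mulShift _ hψ]
      have : (-a - b / c = 0) ↔ c = -b / a := by
        constructor
        · intro h; field_simp at h; rw [eq_div_iff ha]; linear_combination -h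
        · rintro rfl; field_simp; ring
      simp [this]
  simp only [h2]
  simp

lemma LS_ge (F : Type*) [Field F] [Fintype F] (ψ : AddChar F ℂ) (hψ : ψ.IsPrimitive) (a b : F) (ha : a ≠ 0) (n : ℕ) :
    LS F ψ a b (n + 3) = 0 := by
  classical
  obtain ⟨c, hc⟩ : ∃ c, ψ (-(a * c)) ≠ 1 := by
    have h1 := hψ (neg_ne_zero.2 ha)
    rw [AddChar.ne_one_iff] at h1
    obtain ⟨c, hc⟩ := h1
    exact ⟨c, by simpa [AddChar.mulShift_apply] using hc⟩
  have key : LS F ψ a b (n + 3) = ψ (-(a * c)) * LS F ψ a b (n + 3) := by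
    conv_rhs => rw [LS, mul_sum]
    have hdeg : ∀ (c : F), (C c * X ^ (n + 2) : F[X]).degree < ((n + 3 : ℕ) : WithBot ℕ) := by
      intro c; refine lt_of_le_of_lt (degree_C_mul_X_pow_le _ _) ?_
      exact_mod_cast Nat.lt_succ_self _
    have hmem : ∀ (c : F) (h : F[X]), h ∈ mon F (n + 3) → h + C c * X ^ (n + 2) ∈ mon F (n + 3) := by
      intro c h hh
      rw [mem_mon] at hh ⊢
      have hd : h.degree = ((n + 3 : ℕ) : WithBot ℕ) := by rw [degree_eq_natDegree hh.1.ne_zero, hh.2]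
      have hlt : (C c * X ^ (n + 2) : F[X]).degree < h.degree := by rw [hd]; exact hdeg c
      refine ⟨hh.1.add_of_left hlt, ?_⟩
      apply natDegree_eq_of_degree_eq_some
      rw [degree_add_eq_left_of_degree_lt hlt, hd]
    symm
    refine sum_bij (fun h _ => h + C c * X ^ (n + 2)) ?_ ?_ ?_ ?_
    · intro h hh; exact hmem c h hh
    · intro h _ h' _ e; exact add_right_cancel e
    · intro h hh
      refine ⟨h + C (-c) * X ^ (n + 2), hmem (-c) h hh, ?_⟩
      simp
    · intro h hh
      have hh' := hmem c h hh
      rw [mem_mon] at hh hh'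
      unfold Lam
      have e0 : (h + C c * X ^ (n + 2)).coeff 0 = h.coeff 0 := by simp [coeff_X_pow]
      have e1 : (h + C c * X ^ (n + 2)).coeff 1 = h.coeff 1 := by simp [coeff_X_pow]
      rw [nextCoeff_of_natDegree_pos (p := h) (by omega), nextCoeff_of_natDegree_pos (by omega), hh.2, hh'.2, e0, e1]
      split_ifs with h0
      · simp
      · rw [← AddChar.map_add_eq_mul]
        congr 1
        have : n + 3 - 1 = n + 2 := by omega
        rw [this, coeff_add, coeff_C_mul, coeff_X_pow, if_pos rfl]
        ring
  have : (1 - ψ (-(a * c))) * LS F ψ a b (n + 3) = 0 := by linear_combination key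
  rcases mul_eq_zero.1 this with h | h
  · exact absurd (sub_eq_zero.1 h).symm hc
  · exact h

/-- recurrences for the extension sums -/
lemma KS_rec (F : Type*) [Field F] [Fintype F] (p : ℕ) [Fact p.Prime] [CharP F p] (ψ : AddChar F ℂ) (hψ : ψ.IsPrimitive)
    (a b : F) (ha : a ≠ 0) (hb : b ≠ 0) :
    KS F (FiniteField.Extension F p (0 + 1)) ψ a b = KL F ψ a b ∧
    KS F (FiniteField.Extension F p (1 + 1)) ψ a b = 2 * Fintype.card F - KL F ψ a b ^ 2 ∧
    ∀ m, KS F (FiniteField.Extension F p (m + 2 + 1)) ψ a b =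
      - KL F ψ a b * KS F (FiniteField.Extension F p (m + 1 + 1)) ψ a b
      - Fintype.card F * KS F (FiniteField.Extension F p (m + 1)) ψ a b := by
  have r1 := LS_rec F p ψ a b 1
  have r2 := LS_rec F p ψ a b 2
  have h0 := LS_zero F ψ a b
  have h1 := LS_one F ψ a b
  have h2 := LS_two F ψ hψ a b ha hb
  simp only [sum_range_succ, range_zero, sum_empty, zero_add, Nat.sub_self, h0, h1, mul_one, Nat.cast_one, one_mul] at r1
  simp only [sum_range_succ, range_zero, sum_empty, zero_add, Nat.sub_self, h0, h1, h2, mul_one,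
    show 2 - 1 = 1 from rfl, show 1 + 1 = 2 from rfl] at r2
  refine ⟨r1.symm, ?_, ?_⟩
  · rw [← r1] at r2
    push_cast at r2
    linear_combination -r2
  · intro m
    have r3 := LS_rec F p ψ a b (m + 3)
    rw [LS_ge F ψ hψ a b ha, mul_zero, sum_range_succ, sum_range_succ, sum_range_succ] at r3
    have z : ∑ j ∈ range m, KS F (FiniteField.Extension F p (j + 1)) ψ a b * LS F ψ a b (m + 3 - (j + 1)) = 0 := by
      refine sum_eq_zero fun j hj => ?_
      rw [mem_range] at hj
      obtain ⟨k, hk⟩ : ∃ k, m + 3 - (j + 1) = k + 3 := ⟨m - 1 - j, by omega⟩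
      rw [hk, LS_ge F ψ hψ a b ha, mul_zero]
    rw [z, show m + 3 - (m + 1) = 2 by omega, show m + 3 - (m + 1 + 1) = 1 by omega,
      show m + 3 - (m + 2 + 1) = 0 by omega, h0, h1, h2] at r3
    linear_combination -r3

end Kloo

open Finset
namespace Kloo
open Polynomial

lemma lucas_lower (t q : ℝ) (u : ℕ → ℝ) (h0 : u 0 = 2) (h1 : u 1 = t)
    (hr : ∀ m, u (m + 2) = t * u (m + 1) - q * u m) (m : ℕ) : -2 * q ^ m ≤ u (2 * m) := by
  obtain ⟨z, hz⟩ := IsAlgClosed.exists_pow_nat_eq ((t : ℂ) ^ 2 - 4 * q) (n := 2) (by norm_num)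
  have hu : ∀ m, (u m : ℂ) = ((t + z) / 2) ^ m + ((t - z) / 2) ^ m := by
    intro m
    induction m using Nat.twoStepInduction with
    | zero => simp [h0]; norm_num
    | one => simp [h1]; ring
    | more n ih1 ih2 =>
      rw [hr]; push_cast; rw [ih1, ih2]
      have hq : (q : ℂ) = ((t + z) / 2) * ((t - z) / 2) := by linear_combination (1/4) * hz
      rw [hq, pow_succ, pow_succ, pow_succ, pow_succ]; ring
  have h2 : (u (2 * m) : ℂ) = ((u m ^ 2 - 2 * q ^ m : ℝ) : ℂ) := by
    push_cast
    rw [hu, hu]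
    have hq : (q : ℂ) = ((t + z) / 2) * ((t - z) / 2) := by linear_combination (1/4) * hz
    rw [hq, mul_pow, pow_mul', pow_mul']; ring
  have h3 : u (2 * m) = u m ^ 2 - 2 * q ^ m := by exact_mod_cast h2
  rw [h3]; nlinarith [sq_nonneg (u m)]

lemma lucas_big (t q : ℝ) (u : ℕ → ℝ) (h0 : u 0 = 2) (h1 : u 1 = t) (hq : 0 < q)
    (hr : ∀ m, u (m + 2) = t * u (m + 1) - q * u m) (ht : 4 * q < t ^ 2) :
    ∃ g : ℝ, q < g ∧ ∀ m, g ^ m ≤ u (2 * m) := by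
  set z := Real.sqrt (t ^ 2 - 4 * q) with hz
  have hz2 : z ^ 2 = t ^ 2 - 4 * q := Real.sq_sqrt (by linarith)
  have hz0 : 0 ≤ z := Real.sqrt_nonneg _
  have hu : ∀ m, u m = ((t + z) / 2) ^ m + ((t - z) / 2) ^ m := by
    intro m
    induction m using Nat.twoStepInduction with
    | zero => simp [h0]; norm_num
    | one => simp [h1]; ring
    | more n ih1 ih2 =>
      rw [hr]; rw [ih1, ih2]
      have hq : q = ((t + z) / 2) * ((t - z) / 2) := by linear_combination (1/4) * hz2
      rw [hq, pow_succ, pow_succ, pow_succ, pow_succ]; ring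
  have hz0' : 0 < z := Real.sqrt_pos.2 (by linarith)
  rcases le_total 0 t with htn | htn
  · refine ⟨((t + z) / 2) ^ 2, ?_, ?_⟩
    · nlinarith [mul_nonneg htn hz0]
    · intro m
      rw [hu, ← pow_mul]
      have : 0 ≤ ((t - z) / 2) ^ (2 * m) := by rw [pow_mul]; positivity
      linarith
  · refine ⟨((t - z) / 2) ^ 2, ?_, ?_⟩
    · nlinarith [mul_nonneg (neg_nonneg.2 htn) hz0]
    · intro m
      rw [hu, ← pow_mul]
      have : 0 ≤ ((t + z) / 2) ^ (2 * m) := by rw [pow_mul]; positivity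
      linarith

lemma KL_conj (F : Type*) [Field F] [Fintype F] (ψ : AddChar F ℂ) (a b : F) :
    (starRingEnd ℂ) (KL F ψ a b) = KL F ψ a b := by
  classical
  conv_rhs => rw [KL_eq_sum_neg]
  rw [KL, map_sum]
  refine sum_congr rfl fun x _ => ?_
  split_ifs with h
  · simp
  · rw [← AddChar.map_neg_eq_conj]
    congr 1; rw [inv_eq_one_div]; ring

lemma sum_KS {F K : Type*} [Field F] [Fintype F] [Field K] [Fintype K] [DecidableEq F] [DecidableEq K] [Algebra F K]
    (ψ : AddChar F ℂ) (hψ : ψ.IsPrimitive) (a b : F) :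
    ∑ s ∈ univ.erase (0 : F), KS F K ψ (s * a) (s * b) =
      Fintype.card F * (univ.filter (fun x : K => x ≠ 0 ∧
        Algebra.trace F K (algebraMap F K a * x + algebraMap F K b * x⁻¹) = 0)).card - (Fintype.card K - 1) := by
  classical
  have h0 : KS F K ψ (0 * a) (0 * b) = Fintype.card K - 1 := by
    simp only [KS, zero_mul, map_zero, add_zero, AddChar.map_zero_eq_one]
    have : ∀ x : K, (if x = 0 then (0 : ℂ) else 1) = 1 - if x = 0 then 1 else 0 := by
      intro x; split_ifs <;> simp
    simp only [this, sum_sub_distrib]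
    simp
  have h1 : ∑ s : F, KS F K ψ (s * a) (s * b) = Fintype.card F * (univ.filter (fun x : K => x ≠ 0 ∧
        Algebra.trace F K (algebraMap F K a * x + algebraMap F K b * x⁻¹) = 0)).card := by
    simp only [KS]
    rw [sum_comm, card_filter, Nat.cast_sum, mul_sum]
    refine sum_congr rfl fun x _ => ?_
    by_cases hx : x = 0
    · simp [hx]
    · simp only [hx, if_false, ne_eq, not_false_eq_true, true_and]
      have : ∀ s : F, Algebra.trace F K (algebraMap F K (s * a) * x + algebraMap F K (s * b) * x⁻¹) =
          s * Algebra.trace F K (algebraMap F K a * x + algebraMap F K b * x⁻¹) := by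
        intro s
        rw [← smul_eq_mul (a := s) (b := Algebra.trace F K _), ← map_smul]
        congr 1
        rw [Algebra.smul_def, map_mul, map_mul]; ring
      simp only [this]
      rw [AddChar.sum_mulShift _ hψ]
      split_ifs <;> simp
  rw [← h1, ← h0, ← add_sum_erase univ _ (mem_univ (0 : F))]
  ring

theorem weil (F : Type*) [Field F] [Fintype F] (hF : ringChar F ≠ 2) (ψ : AddChar F ℂ) (hψ : ψ.IsPrimitive)
    (a b : F) (ha : a ≠ 0) (hb : b ≠ 0) : ‖KL F ψ a b‖ ≤ 2 * Real.sqrt (Fintype.card F) := by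
  classical
  set p := ringChar F with hp
  have : Fact p.Prime := ⟨CharP.char_is_prime F p⟩
  have : CharP F p := ringChar.charP F
  set q := Fintype.card F with hq
  have hq2 : 2 ≤ q := Fintype.one_lt_card
  have hreal : ∀ s, ((KL F ψ (s * a) (s * b)).re : ℂ) = KL F ψ (s * a) (s * b) := fun s =>
    Complex.conj_eq_iff_re.1 (KL_conj F ψ _ _)
  set t : F → ℝ := fun s => -(KL F ψ (s * a) (s * b)).re with ht
  have htc : ∀ s, KL F ψ (s * a) (s * b) = -(t s : ℂ) := by
    intro s; rw [ht]; push_cast; rw [hreal]; ring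
  set u : F → ℕ → ℝ := fun s n => match n with
    | 0 => 2
    | (m + 1) => -(KS F (FiniteField.Extension F p (m + 1)) ψ (s * a) (s * b)).re with hu
  have hKS : ∀ s ≠ 0, ∀ m, KS F (FiniteField.Extension F p (m + 1)) ψ (s * a) (s * b) = -(u s (m + 1) : ℂ) := by
    intro s hs m
    obtain ⟨k1, k2, k3⟩ := KS_rec F p ψ hψ (s * a) (s * b) (mul_ne_zero hs ha) (mul_ne_zero hs hb)
    have : ∃ r : ℝ, KS F (FiniteField.Extension F p (m + 1)) ψ (s * a) (s * b) = r := by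
      induction m using Nat.twoStepInduction with
      | zero => exact ⟨_, by rw [k1, htc, ← Complex.ofReal_neg]⟩
      | one => exact ⟨2 * q - t s ^ 2, by rw [k2, htc]; push_cast; ring⟩
      | more n ih1 ih2 =>
        obtain ⟨r1, h1⟩ := ih1
        obtain ⟨r2, h2⟩ := ih2
        exact ⟨t s * r2 - q * r1, by rw [k3, h1, h2, htc]; push_cast; ring⟩
    obtain ⟨r, hr⟩ := this
    simp only [hu]
    rw [hr]; simp
  have hu0 : ∀ s, u s 0 = 2 := fun s => rfl
  have hu1 : ∀ s ≠ 0, u s 1 = t s := by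
    intro s hs
    have := hKS s hs 0
    rw [(KS_rec F p ψ hψ (s * a) (s * b) (mul_ne_zero hs ha) (mul_ne_zero hs hb)).1, htc] at this
    have := neg_injective this
    exact_mod_cast this.symm
  have hur : ∀ s ≠ 0, ∀ m, u s (m + 2) = t s * u s (m + 1) - q * u s m := by
    intro s hs m
    obtain ⟨k1, k2, k3⟩ := KS_rec F p ψ hψ (s * a) (s * b) (mul_ne_zero hs ha) (mul_ne_zero hs hb)
    rcases m with _ | m
    · have e := hKS s hs 1
      rw [k2, htc] at e
      have : (u s (1 + 1) : ℂ) = ((t s * t s - q * 2 : ℝ) : ℂ) := by push_cast; linear_combination e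
      have : u s (1 + 1) = t s * t s - q * 2 := by exact_mod_cast this
      rw [hu0 s, zero_add, zero_add, hu1 s hs]; exact this
    · have e := k3 m
      rw [hKS s hs, hKS s hs, hKS s hs, htc] at e
      have : (u s (m + 2 + 1) : ℂ) = ((t s * u s (m + 1 + 1) - q * u s (m + 1) : ℝ) : ℂ) := by
        push_cast; linear_combination -e
      exact_mod_cast this
  have hbound : ∀ j, 3 ≤ j → u 1 (2 * (p * j)) ≤ 4 * q * (q : ℝ) ^ (p * j) := by
    intro j hj
    have hp2 : 2 ≤ p := (Fact.out : p.Prime).two_le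
    have hpj : 2 < p * j := by nlinarith
    obtain ⟨m, hm⟩ : ∃ m, 2 * (p * j) = m + 1 := ⟨2 * (p * j) - 1, by omega⟩
    have : CharP (FiniteField.Extension F p (m + 1)) p :=
      charP_of_injective_algebraMap (algebraMap F _).injective p
    have tc := trace_count (F := F) (K := FiniteField.Extension F p (m + 1)) p q j hF rfl
      (by rw [FiniteField.finrank_extension, hm]) (Nat.pow_lt_pow_right (by omega) hpj) a b ha hb
    have sk := sum_KS (F := F) (K := FiniteField.Extension F p (m + 1)) ψ hψ a b
    rw [sum_congr rfl (fun s hs => hKS s (mem_erase.1 hs).1 m)] at sk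
    simp only [show ∀ s, u s (m + 1) = u s (2 * (p * j)) from fun s => by rw [hm]] at sk
    have hcK : (Fintype.card (FiniteField.Extension F p (m + 1)) : ℝ) = ((q : ℝ) ^ (p * j)) ^ 2 := by
      rw [← Nat.card_eq_fintype_card, FiniteField.natCard_extension, Nat.card_eq_fintype_card, ← hq, ← hm, mul_comm 2, pow_mul]
      push_cast; rfl
    rw [sum_neg_distrib] at sk
    have tc' : (((q : ℝ) ^ (p * j)) ^ 2 : ℝ) - 1 - (2 * q - 1) * q ^ (p * j) ≤
      q * (univ.filter (fun x : FiniteField.Extension F p (m + 1) => x ≠ 0 ∧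
        Algebra.trace F _ (algebraMap F _ a * x + algebraMap F _ b * x⁻¹) = 0)).card := by
      exact_mod_cast tc
    have sk' : -(∑ s ∈ univ.erase (0 : F), u s (2 * (p * j))) = q * ((univ.filter (fun x : FiniteField.Extension F p (m + 1) => x ≠ 0 ∧
        Algebra.trace F _ (algebraMap F _ a * x + algebraMap F _ b * x⁻¹) = 0)).card : ℝ) -
        (Fintype.card (FiniteField.Extension F p (m + 1)) - 1) := by
      exact_mod_cast sk
    rw [hcK] at sk'
    have hs1 : ∑ s ∈ univ.erase (0 : F), u s (2 * (p * j)) ≤ (2 * q - 1) * (q : ℝ) ^ (p * j) := by linarith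
    have h1m : (1 : F) ∈ univ.erase (0 : F) := by simp
    rw [← add_sum_erase _ _ h1m] at hs1
    have hlow : ∑ s ∈ (univ.erase (0 : F)).erase 1, (-2 * (q : ℝ) ^ (p * j)) ≤
        ∑ s ∈ (univ.erase (0 : F)).erase 1, u s (2 * (p * j)) := by
      refine sum_le_sum fun s hs => ?_
      have hs0 : s ≠ 0 := by simp at hs; exact hs.2
      exact lucas_lower (t s) q (u s) (hu0 s) (hu1 s hs0) (hur s hs0) _
    rw [sum_const, nsmul_eq_mul] at hlow
    have hcle : (((univ.erase (0 : F)).erase 1).card : ℝ) ≤ q := by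
      exact_mod_cast card_le_univ _
    have hpos : (0 : ℝ) ≤ (q : ℝ) ^ (p * j) := by positivity
    nlinarith [mul_le_mul_of_nonneg_right hcle hpos]
  by_contra hcon
  push Not at hcon
  have hq0 : (0 : ℝ) < q := by exact_mod_cast (by omega : 0 < q)
  have ht1 : 4 * q < t 1 ^ 2 := by
    have e := htc 1
    rw [one_mul, one_mul] at e
    rw [e, norm_neg, Complex.norm_real, Real.norm_eq_abs] at hcon
    have h0 : 0 ≤ 2 * Real.sqrt q := by positivity
    have := pow_lt_pow_left₀ hcon h0 (n := 2) (by norm_num)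
    rw [sq_abs, mul_pow, Real.sq_sqrt hq0.le] at this
    linarith
  obtain ⟨g, hg, hgu⟩ := lucas_big (t 1) q (u 1) (hu0 1) (hu1 1 one_ne_zero) hq0 (hur 1 one_ne_zero) ht1
  have hr : 1 < g / q := by rw [lt_div_iff₀ hq0]; linarith
  obtain ⟨N, hN⟩ := pow_unbounded_of_one_lt (4 * (q : ℝ)) hr
  have hj := hbound (N + 3) (by omega)
  have hg' := hgu (p * (N + 3))
  have h1 : (g / q) ^ N ≤ (g / q) ^ (p * (N + 3)) := by
    apply pow_le_pow_right₀ hr.le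
    have hp2 : 2 ≤ p := (Fact.out : p.Prime).two_le
    nlinarith
  have h2 : (g / q) ^ (p * (N + 3)) ≤ 4 * q := by
    rw [div_pow, div_le_iff₀ (by positivity)]; linarith
  linarith
end Kloo

open Finset
namespace Kloo

section Salie
variable {F : Type*} [Field F] [Fintype F] [DecidableEq F]

/-- complex quadratic character -/
noncomputable def eta (F : Type*) [Field F] [Fintype F] [DecidableEq F] : MulChar F ℂ :=
  (quadraticChar F).ringHomComp (Int.castRingHom ℂ)

lemma eta_apply (x : F) : eta F x = ((quadraticChar F x : ℤ) : ℂ) := rfl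

@[simp] lemma eta_zero : eta F 0 = 0 := by
  rw [eta_apply]; simp

lemma eta_sq {x : F} (hx : x ≠ 0) : eta F x ^ 2 = 1 := by
  rw [eta_apply, ← Int.cast_pow, quadraticChar_sq_one hx, Int.cast_one]

lemma eta_sq' {x : F} (hx : x ≠ 0) : eta F (x ^ 2) = 1 := by
  rw [map_pow, eta_sq hx]

lemma eta_inv (x : F) : eta F x⁻¹ = eta F x := by
  by_cases hx : x = 0
  · simp [hx]
  · have h1 : eta F x⁻¹ * eta F x = 1 := by rw [← map_mul, inv_mul_cancel₀ hx, map_one]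
    have h2 := eta_sq hx
    calc eta F x⁻¹ = eta F x⁻¹ * eta F x ^ 2 := by rw [h2, mul_one]
      _ = (eta F x⁻¹ * eta F x) * eta F x := by ring
      _ = eta F x := by rw [h1, one_mul]

lemma norm_eta {x : F} (hx : x ≠ 0) : ‖eta F x‖ = 1 := by
  have := congrArg norm (eta_sq hx)
  rw [norm_pow, norm_one] at this
  exact (pow_eq_one_iff_of_nonneg (norm_nonneg _) two_ne_zero).1 this

/-- the Gauss sum -/
noncomputable def GS (ψ : AddChar F ℂ) : ℂ := ∑ x : F, eta F x * ψ x

lemma norm_GS (hF : ringChar F ≠ 2) {ψ : AddChar F ℂ} (hψ : ψ.IsPrimitive) : ‖GS ψ‖ ^ 2 = Fintype.card F := by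
  have h1 : eta F ≠ 1 := by
    unfold eta
    intro h
    apply quadraticChar_ne_one hF
    ext x
    have := congrArg (fun c : MulChar F ℂ => c x) h
    simp [MulChar.ringHomComp_apply] at this
    simpa using this
  have h2 : (eta F).IsQuadratic := (quadraticChar_isQuadratic F).comp _
  have h3 := gaussSum_sq h1 h2 hψ
  have h4 : gaussSum (eta F) ψ = GS ψ := rfl
  rw [h4] at h3
  have := congrArg norm h3
  rw [norm_pow, norm_mul, norm_eta (neg_ne_zero.2 one_ne_zero), one_mul] at this
  rw [this]; simp

lemma GS_shift (ψ : AddChar F ℂ) {s : F} (hs : s ≠ 0) : ∑ x : F, eta F x * ψ (s * x) = eta F s * GS ψ := by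
  rw [GS, mul_sum]
  refine Fintype.sum_bijective (fun x => s * x) (mulLeft_bijective₀ s hs) _ _ fun x => ?_
  rw [← mul_assoc, ← map_mul, ← mul_assoc, ← sq, map_mul (eta F), eta_sq' hs, one_mul]

lemma sum_psi_sq (hF : ringChar F ≠ 2) {ψ : AddChar F ℂ} (hψ : ψ.IsPrimitive) {s : F} (hs : s ≠ 0) :
    ∑ x : F, ψ (s * x ^ 2) = eta F s * GS ψ := by
  have h1 : ∑ x : F, ψ (s * x ^ 2) = ∑ y : F, (eta F y + 1) * ψ (s * y) := by
    have : ∀ x : F, ψ (s * x ^ 2) = ∑ y : F, if x ^ 2 = y then ψ (s * y) else 0 := by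
      intro x; rw [sum_ite_eq]; simp
    simp only [this]
    rw [sum_comm]
    refine sum_congr rfl fun y _ => ?_
    rw [← sum_filter, sum_const, nsmul_eq_mul]
    congr 1
    have := card_sqrts_eq hF y
    rw [eta_apply]
    exact_mod_cast this
  have h2 : ∑ y : F, ψ (s * y) = 0 := by
    have := AddChar.sum_mulShift s hψ
    rw [if_neg hs] at this
    rw [← Nat.cast_zero, ← this]
    exact sum_congr rfl fun y _ => by rw [mul_comm]
  rw [h1]
  simp only [add_mul, one_mul, sum_add_distrib, h2, add_zero]
  exact GS_shift ψ hs

lemma sum_psi_quad (hF : ringChar F ≠ 2) {ψ : AddChar F ℂ} (hψ : ψ.IsPrimitive) {s : F} (hs : s ≠ 0) (b : F) :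
    ∑ x : F, ψ (s * x ^ 2 + b * x) = ψ (-(b ^ 2 / (4 * s))) * (eta F s * GS ψ) := by
  have h2 : (2 : F) ≠ 0 := Ring.two_ne_zero hF
  have h4 : (4 : F) ≠ 0 := by
    have : (4 : F) = 2 * 2 := by norm_num
    rw [this]; exact mul_ne_zero h2 h2
  rw [← sum_psi_sq hF hψ hs, mul_sum]
  refine Fintype.sum_equiv (Equiv.addRight (b / (2 * s))) _ _ fun x => ?_
  rw [← AddChar.map_add_eq_mul]
  congr 1
  simp only [Equiv.coe_addRight]
  field_simp
  ring

lemma sum_fiber_eta (hF : ringChar F ≠ 2) (u : F) :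
    ∑ x ∈ univ.filter (fun x : F => x ≠ 0 ∧ x + x⁻¹ = u), eta F x = eta F (u - 2) + eta F (u + 2) := by
  have h2 : (2 : F) ≠ 0 := Ring.two_ne_zero hF
  have h4 : eta F 4 = 1 := by
    have : (4 : F) = 2 ^ 2 := by norm_num
    rw [this, eta_sq' h2]
  have hcard : ((univ.filter (fun x : F => x ≠ 0 ∧ x + x⁻¹ = u)).card : ℤ) = quadraticChar F (u ^ 2 - 4) + 1 := by
    rw [← card_sqrts_eq hF]
    norm_cast
    refine card_bij (fun x _ => 2 * x - u) ?_ ?_ ?_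
    · intro x hx
      simp only [mem_filter, mem_univ, true_and] at hx ⊢
      obtain ⟨h1, h3⟩ := hx
      rw [← h3]; field_simp; ring
    · intro x _ x' _ h
      have : 2 * x = 2 * x' := by linear_combination h
      exact mul_left_cancel₀ h2 this
    · intro s hs
      simp only [mem_filter, mem_univ, true_and] at hs
      have hquad : ((s + u) / 2) ^ 2 - u * ((s + u) / 2) + 1 = 0 := by
        field_simp
        linear_combination hs
      have hx0 : (s + u) / 2 ≠ 0 := by
        intro h; rw [h] at hquad; simp at hquad
      refine ⟨(s + u) / 2, ?_, ?_⟩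
      · simp only [mem_filter, mem_univ, true_and]
        refine ⟨hx0, ?_⟩
        generalize (s + u) / 2 = x at hx0 hquad
        field_simp
        linear_combination hquad
      · field_simp; ring
  by_cases hu2 : u = 2
  · subst hu2
    have : univ.filter (fun x : F => x ≠ 0 ∧ x + x⁻¹ = 2) = {1} := by
      ext x
      simp only [mem_filter, mem_univ, true_and, mem_singleton]
      constructor
      · rintro ⟨h0, h⟩
        field_simp at h
        have : (x - 1) ^ 2 = 0 := by linear_combination h
        exact sub_eq_zero.1 (pow_eq_zero_iff two_ne_zero |>.1 this)
      · rintro rfl; refine ⟨one_ne_zero, by norm_num⟩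
    rw [this, sum_singleton, sub_self, show (2 : F) + 2 = 4 by norm_num, h4]
    simp
  by_cases hu2' : u = -2
  · subst hu2'
    have : univ.filter (fun x : F => x ≠ 0 ∧ x + x⁻¹ = -2) = {-1} := by
      ext x
      simp only [mem_filter, mem_univ, true_and, mem_singleton]
      constructor
      · rintro ⟨h0, h⟩
        field_simp at h
        have : (x + 1) ^ 2 = 0 := by linear_combination h
        exact eq_neg_of_add_eq_zero_left (pow_eq_zero_iff two_ne_zero |>.1 this)
      · rintro rfl; refine ⟨neg_ne_zero.2 one_ne_zero, by rw [inv_neg, inv_one]; norm_num⟩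
    rw [this, sum_singleton, neg_add_cancel, show (-2 : F) - 2 = 4 * (-1) by norm_num, map_mul, h4]
    simp
  · have hsame : ∀ x ∈ univ.filter (fun x : F => x ≠ 0 ∧ x + x⁻¹ = u), eta F x = eta F (u - 2) := by
      intro x hx
      simp only [mem_filter, mem_univ, true_and] at hx
      obtain ⟨h0, h⟩ := hx
      have h1 : x - 1 ≠ 0 := by
        intro e
        have : x = 1 := sub_eq_zero.1 e
        apply hu2; rw [← h, this]; norm_num
      have : u - 2 = (x - 1) ^ 2 * x⁻¹ := by rw [← h]; field_simp; ring
      rw [this, map_mul, eta_sq' h1, one_mul, eta_inv]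
    rw [sum_congr rfl hsame, sum_const, nsmul_eq_mul]
    have hc : ((univ.filter (fun x : F => x ≠ 0 ∧ x + x⁻¹ = u)).card : ℂ) = eta F (u - 2) * eta F (u + 2) + 1 := by
      rw [← map_mul, show (u - 2) * (u + 2) = u ^ 2 - 4 by ring, eta_apply]
      exact_mod_cast hcard
    rw [hc]
    have := eta_sq (F := F) (sub_ne_zero.2 hu2)
    linear_combination (eta F (u + 2)) * this

lemma salie_sq (hF : ringChar F ≠ 2) (ψ : AddChar F ℂ) {r : F} (hr : r ≠ 0) :
    ∑ x : F, eta F x * ψ (r * (x + x⁻¹)) = eta F r * GS ψ * (ψ (2 * r) + ψ (-(2 * r))) := by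
  have h1 : ∑ x : F, eta F x * ψ (r * (x + x⁻¹)) = ∑ u : F, (eta F (u - 2) + eta F (u + 2)) * ψ (r * u) := by
    have : ∀ x : F, eta F x * ψ (r * (x + x⁻¹)) =
        ∑ u : F, if x ≠ 0 ∧ x + x⁻¹ = u then eta F x * ψ (r * u) else 0 := by
      intro x
      by_cases hx : x = 0
      · simp [hx]
      · simp [hx]
    simp only [this]
    rw [sum_comm]
    refine sum_congr rfl fun u _ => ?_
    rw [← sum_filter, ← sum_mul, sum_fiber_eta hF]
  rw [h1]
  simp only [add_mul, sum_add_distrib]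
  have e1 : ∑ u : F, eta F (u - 2) * ψ (r * u) = ψ (2 * r) * (eta F r * GS ψ) := by
    rw [← GS_shift ψ hr, mul_sum]
    refine Fintype.sum_equiv (Equiv.subRight 2) _ _ fun u => ?_
    simp only [Equiv.subRight_apply]
    rw [mul_left_comm, ← AddChar.map_add_eq_mul]
    congr 2; ring
  have e2 : ∑ u : F, eta F (u + 2) * ψ (r * u) = ψ (-(2 * r)) * (eta F r * GS ψ) := by
    rw [← GS_shift ψ hr, mul_sum]
    refine Fintype.sum_equiv (Equiv.addRight 2) _ _ fun u => ?_
    simp only [Equiv.coe_addRight]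
    rw [mul_left_comm, ← AddChar.map_add_eq_mul]
    congr 2; ring
  rw [e1, e2]; ring

lemma psi_norm (ψ : AddChar F ℂ) (x : F) : ‖ψ x‖ = 1 := AddChar.norm_apply ψ x

lemma salie_bound (hF : ringChar F ≠ 2) {ψ : AddChar F ℂ} (hψ : ψ.IsPrimitive) (a b : F) (ha : a ≠ 0) :
    ‖∑ x : F, eta F x * ψ (a * x + b * x⁻¹)‖ ≤ 2 * Real.sqrt (Fintype.card F) := by
  have hG : ‖GS ψ‖ = Real.sqrt (Fintype.card F) := by
    rw [← norm_GS hF hψ, Real.sqrt_sq (norm_nonneg _)]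
  by_cases hb : b = 0
  · subst hb
    simp only [zero_mul, add_zero]
    rw [GS_shift ψ ha, norm_mul, norm_eta ha, hG]
    linarith [Real.sqrt_nonneg (Fintype.card F)]
  by_cases hsq : IsSquare (a * b)
  · obtain ⟨r, hr⟩ := hsq
    have hr0 : r ≠ 0 := by rintro rfl; simp [ha, hb] at hr
    have h1 : ∑ x : F, eta F x * ψ (a * x + b * x⁻¹) = eta F (r / a) * ∑ x : F, eta F x * ψ (r * (x + x⁻¹)) := by
      rw [mul_sum]
      symm
      have hra : r / a ≠ 0 := div_ne_zero hr0 ha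
      refine Fintype.sum_bijective (fun x => (r / a) * x) (mulLeft_bijective₀ _ hra) _ _ fun x => ?_
      rw [← mul_assoc, ← map_mul]
      by_cases hx : x = 0
      · simp [hx]
      congr 2
      have : r * r = a * b := hr.symm
      field_simp
      rw [sq, this]; ring
    rw [h1, salie_sq hF ψ hr0, norm_mul, norm_mul, norm_mul, norm_eta (div_ne_zero hr0 ha), norm_eta hr0, hG, one_mul, one_mul]
    have : ‖ψ (2 * r) + ψ (-(2 * r))‖ ≤ 2 := by
      refine (norm_add_le _ _).trans ?_
      rw [psi_norm, psi_norm]; norm_num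
    nlinarith [Real.sqrt_nonneg (Fintype.card F)]
  · have hc : eta F (a * b) = -1 := by
      rw [eta_apply, quadraticChar_neg_one_iff_not_isSquare.2 hsq]; simp
    have hba : b / a ≠ 0 := div_ne_zero hb ha
    have hinv : ∑ x : F, eta F x * ψ (a * x + b * x⁻¹) = - ∑ x : F, eta F x * ψ (a * x + b * x⁻¹) := by
      rw [← sum_neg_distrib]
      have hbij : Function.Involutive (fun x : F => (b / a) * x⁻¹) := by
        intro x; by_cases hx : x = 0
        · simp [hx]
        · simp only; field_simp
      refine Fintype.sum_bijective (fun x => (b / a) * x⁻¹) hbij.bijective _ _ fun x => ?_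
      by_cases hx : x = 0
      · simp [hx]
      have e : eta F (b / a) = -1 := by
        rw [← hc, div_eq_mul_inv, map_mul, eta_inv, map_mul, mul_comm]
      rw [map_mul, e, eta_inv, neg_one_mul, neg_mul, neg_neg]
      congr 2
      field_simp
      ring
    have : ∑ x : F, eta F x * ψ (a * x + b * x⁻¹) = 0 := by
      exact self_eq_neg.1 hinv
    rw [this, norm_zero]; positivity

lemma KL_bound (hF : ringChar F ≠ 2) {ψ : AddChar F ℂ} (hψ : ψ.IsPrimitive) (a b : F) (ha : a ≠ 0) :
    ‖KL F ψ a b‖ ≤ 2 * Real.sqrt (Fintype.card F) := by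
  by_cases hb : b = 0
  · have h1 : KL F ψ a b = -1 := by
      subst hb
      unfold KL
      have h2 : ∑ y : F, ψ (a * y) = 0 := by
        have := AddChar.sum_mulShift a hψ
        rw [if_neg ha] at this
        rw [← Nat.cast_zero, ← this]
        exact sum_congr rfl fun y _ => by rw [mul_comm]
      have h3 : ∀ x : F, (if x = 0 then 0 else ψ (a * x + 0 * x⁻¹)) = ψ (a * x) - if x = 0 then 1 else 0 := by
        intro x; split_ifs with h <;> simp [h]
      have h4 : ∑ x : F, (if x = 0 then 0 else ψ (a * x + 0 * x⁻¹)) = -1 := by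
        rw [sum_congr rfl fun x _ => h3 x, sum_sub_distrib, h2]; simp
      convert h4
    rw [h1, norm_neg, norm_one]
    have : (1 : ℝ) ≤ Real.sqrt (Fintype.card F) := by
      rw [Real.one_le_sqrt]; exact_mod_cast Fintype.card_pos
    linarith
  · exact weil F hF ψ hψ a b ha hb

lemma twisted_bound (hF : ringChar F ≠ 2) {ψ : AddChar F ℂ} (hψ : ψ.IsPrimitive) (a b : F) (ha : a ≠ 0) (d : ℕ) (hd : d ≠ 0) :
    ‖∑ x : F, eta F x ^ d * ψ (a * x + b * x⁻¹)‖ ≤ 2 * Real.sqrt (Fintype.card F) := by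
  rcases Nat.even_or_odd' d with ⟨k, rfl | rfl⟩
  · have : ∑ x : F, eta F x ^ (2 * k) * ψ (a * x + b * x⁻¹) = KL F ψ a b := by
      unfold KL
      refine sum_congr rfl fun x _ => ?_
      by_cases hx : x = 0
      · simp [hx, hd]
      · rw [if_neg hx, pow_mul, eta_sq hx, one_pow, one_mul]
    rw [this]; exact KL_bound hF hψ a b ha
  · have : ∑ x : F, eta F x ^ (2 * k + 1) * ψ (a * x + b * x⁻¹) = ∑ x : F, eta F x * ψ (a * x + b * x⁻¹) := by
      refine sum_congr rfl fun x _ => ?_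
      by_cases hx : x = 0
      · simp [hx]
      · rw [pow_succ, pow_mul, eta_sq hx, one_pow, one_mul]
    rw [this]; exact salie_bound hF hψ a b ha
end Salie
end Kloo

open Finset
namespace Kloo

section Fourier
variable {F : Type*} [Field F] [Fintype F] [DecidableEq F] {d : ℕ}

lemma psi_sum_prod (ψ : AddChar F ℂ) (f : Fin d → F) : ψ (∑ i, f i) = ∏ i, ψ (f i) := by
  have h : ∀ s : Finset (Fin d), ψ (∑ i ∈ s, f i) = ∏ i ∈ s, ψ (f i) := by
    intro s
    induction s using Finset.induction_on with
    | empty => simp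
    | insert a s ha ih => rw [sum_insert ha, prod_insert ha, AddChar.map_add_eq_mul, ih]
  exact h univ

lemma psi_dot (ψ : AddChar F ℂ) (x z : Fin d → F) : ψ (x ⬝ᵥ z) = ∏ i, ψ (x i * z i) := by
  rw [dotProduct]
  exact psi_sum_prod ψ _

lemma sum_pi_prod (g : Fin d → F → ℂ) : ∑ x : Fin d → F, ∏ i, g i (x i) = ∏ i, ∑ y, g i y := by
  rw [prod_univ_sum, Fintype.piFinset_univ]

lemma orth {ψ : AddChar F ℂ} (hψ : ψ.IsPrimitive) (z : Fin d → F) :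
    ∑ x : Fin d → F, ψ (x ⬝ᵥ z) = if z = 0 then (Fintype.card F : ℂ) ^ d else 0 := by
  simp only [psi_dot]
  rw [sum_pi_prod (fun i y => ψ (y * z i))]
  have : ∀ i, ∑ y, ψ (y * z i) = if z i = 0 then (Fintype.card F : ℂ) else 0 := by
    intro i
    rw [AddChar.sum_mulShift _ hψ]; split_ifs <;> simp
  simp only [this]
  split_ifs with h
  · simp [h]
  · obtain ⟨i, hi⟩ := Function.ne_iff.1 h
    exact prod_eq_zero (mem_univ i) (by simpa using hi)

/-- Fourier transform -/
noncomputable def hat (ψ : AddChar F ℂ) (g : (Fin d → F) → ℂ) (x : Fin d → F) : ℂ := ∑ z, g z * ψ (x ⬝ᵥ z)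

lemma parseval {ψ : AddChar F ℂ} (hψ : ψ.IsPrimitive) (g : (Fin d → F) → ℂ) :
    ∑ x, ‖hat ψ g x‖ ^ 2 = (Fintype.card F : ℝ) ^ d * ∑ z, ‖g z‖ ^ 2 := by
  have key : (∑ x, hat ψ g x * (starRingEnd ℂ) (hat ψ g x)) =
      (Fintype.card F : ℂ) ^ d * ∑ z, g z * (starRingEnd ℂ) (g z) := by
    have h1 : ∀ x, hat ψ g x * (starRingEnd ℂ) (hat ψ g x) =
        ∑ y, ∑ z, g y * (starRingEnd ℂ) (g z) * ψ (x ⬝ᵥ (y - z)) := by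
      intro x
      unfold hat
      rw [map_sum, sum_mul_sum]
      refine sum_congr rfl fun y _ => sum_congr rfl fun z _ => ?_
      rw [map_mul, ← AddChar.map_neg_eq_conj, dotProduct_sub, sub_eq_add_neg, AddChar.map_add_eq_mul]
      ring
    simp only [h1]
    rw [sum_comm, mul_sum]
    refine sum_congr rfl fun y _ => ?_
    rw [sum_comm]
    simp only [← mul_sum, orth hψ, sub_eq_zero, mul_ite, mul_zero]
    rw [sum_ite_eq, if_pos (mem_univ _)]
    ring
  have : ∀ z : ℂ, z * (starRingEnd ℂ) z = ((‖z‖ ^ 2 : ℝ) : ℂ) := by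
    intro z; rw [Complex.mul_conj, Complex.normSq_eq_norm_sq]
  simp only [this] at key
  exact_mod_cast key

lemma hat_conv (ψ : AddChar F ℂ) (k g : (Fin d → F) → ℂ) (x : Fin d → F) :
    hat ψ (fun u => ∑ y, k (u - y) * g y) x = hat ψ k x * hat ψ g x := by
  unfold hat
  simp only [sum_mul]
  rw [sum_comm]
  conv_rhs => rw [← sum_mul, mul_comm, sum_mul]
  refine sum_congr rfl fun y _ => ?_
  rw [mul_sum]
  refine Fintype.sum_equiv (Equiv.subRight y) _ _ fun u => ?_
  simp only [Equiv.subRight_apply, dotProduct_sub, sub_eq_add_neg, dotProduct_add, AddChar.map_add_eq_mul]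
  have : ψ (x ⬝ᵥ y) * ψ (x ⬝ᵥ -y) = 1 := by
    rw [← AddChar.map_add_eq_mul, dotProduct_neg, add_neg_cancel, AddChar.map_zero_eq_one]
  linear_combination -(k (u + -y) * g y * ψ (x ⬝ᵥ u)) * this

lemma conv_bound {ψ : AddChar F ℂ} (hψ : ψ.IsPrimitive) (k g : (Fin d → F) → ℂ) (B : ℝ)
    (hk : ∀ x, ‖hat ψ k x‖ ^ 2 ≤ B) :
    ∑ u, ‖∑ y, k (u - y) * g y‖ ^ 2 ≤ B * ∑ y, ‖g y‖ ^ 2 := by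
  have h1 := parseval hψ (fun u => ∑ y, k (u - y) * g y)
  have h2 := parseval hψ g
  have hq : (0 : ℝ) < (Fintype.card F : ℝ) ^ d := by
    have : 0 < Fintype.card F := Fintype.card_pos
    positivity
  have h3 : ∑ x, ‖hat ψ (fun u => ∑ y, k (u - y) * g y) x‖ ^ 2 ≤ B * ∑ x, ‖hat ψ g x‖ ^ 2 := by
    rw [mul_sum]
    refine sum_le_sum fun x _ => ?_
    rw [hat_conv, norm_mul, mul_pow]
    exact mul_le_mul_of_nonneg_right (hk x) (by positivity)
  rw [h1, h2] at h3
  have : (Fintype.card F : ℝ) ^ d * ∑ u, ‖∑ y, k (u - y) * g y‖ ^ 2 ≤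
    (Fintype.card F : ℝ) ^ d * (B * ∑ y, ‖g y‖ ^ 2) := by linarith
  exact le_of_mul_le_mul_left this hq

/-- the kernel of a diagonal form -/
noncomputable def ker (w : Fin d → F) (t : F) (z : Fin d → F) : ℂ :=
  (if ∑ i, w i * z i ^ 2 = t then 1 else 0) - 1 / (Fintype.card F : ℂ)

lemma ker_eq {ψ : AddChar F ℂ} (hψ : ψ.IsPrimitive) (w : Fin d → F) (t : F) (z : Fin d → F) :
    ker w t z = 1 / (Fintype.card F : ℂ) * ∑ s ∈ univ.erase (0 : F), ψ (s * (∑ i, w i * z i ^ 2 - t)) := by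
  have h1 := AddChar.sum_mulShift (∑ i, w i * z i ^ 2 - t) hψ
  rw [← add_sum_erase univ _ (mem_univ (0 : F)), zero_mul, AddChar.map_zero_eq_one] at h1
  have hq : (Fintype.card F : ℂ) ≠ 0 := by exact_mod_cast Fintype.card_ne_zero
  rw [ker, eq_sub_of_add_eq' h1]
  simp only [sub_eq_zero]
  split_ifs <;> field_simp
  simp

lemma hat_ker (hF : ringChar F ≠ 2) {ψ : AddChar F ℂ} (hψ : ψ.IsPrimitive) (w : Fin d → F) (hw : ∀ i, w i ≠ 0) (hd : d ≠ 0)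
    (t : F) (x : Fin d → F) :
    hat ψ (ker w t) x = 1 / (Fintype.card F : ℂ) * ((∏ i, eta F (w i)) * GS ψ ^ d) *
      ∑ s : F, eta F s ^ d * ψ (-t * s + (-∑ i, x i ^ 2 / (4 * w i)) * s⁻¹) := by
  have h1 : hat ψ (ker w t) x = 1 / (Fintype.card F : ℂ) * ∑ s ∈ univ.erase (0 : F),
      ψ (-t * s) * ∑ z : Fin d → F, ∏ i, ψ ((s * w i) * z i ^ 2 + x i * z i) := by
    unfold hat
    simp only [ker_eq hψ, mul_assoc, ← mul_sum]
    congr 1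
    simp only [sum_mul, mul_sum]
    rw [sum_comm]
    refine sum_congr rfl fun s _ => sum_congr rfl fun z _ => ?_
    rw [← psi_sum_prod, ← AddChar.map_add_eq_mul, ← AddChar.map_add_eq_mul]
    congr 1
    rw [sum_add_distrib, mul_sub, mul_sum, dotProduct]
    have : ∀ i, s * (w i * z i ^ 2) = s * w i * z i ^ 2 := fun i => by ring
    simp only [this]; ring
  rw [h1, mul_assoc]
  congr 1
  rw [mul_sum, ← add_sum_erase univ _ (mem_univ (0 : F))]
  rw [eta_zero, zero_pow hd, zero_mul, mul_zero, zero_add]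
  refine sum_congr rfl fun s hs => ?_
  have hs0 : s ≠ 0 := (mem_erase.1 hs).1
  rw [sum_pi_prod (fun i y => ψ ((s * w i) * y ^ 2 + x i * y))]
  simp only [sum_psi_quad hF hψ (mul_ne_zero hs0 (hw _)), prod_mul_distrib, map_mul (eta F)]
  rw [← psi_sum_prod]
  simp only [prod_const, card_univ, Fintype.card_fin]
  rw [AddChar.map_add_eq_mul]
  have : ∑ i, -(x i ^ 2 / (4 * (s * w i))) = (-∑ i, x i ^ 2 / (4 * w i)) * s⁻¹ := by
    rw [sum_neg_distrib, neg_mul, sum_mul]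
    congr 1
    refine sum_congr rfl fun i _ => ?_
    rw [div_mul_eq_mul_div, div_eq_mul_inv, div_eq_mul_inv, mul_inv, mul_inv, mul_inv]; ring
  rw [this]; ring

lemma hat_ker_bound (hF : ringChar F ≠ 2) {ψ : AddChar F ℂ} (hψ : ψ.IsPrimitive) (w : Fin d → F) (hw : ∀ i, w i ≠ 0) (hd : 1 ≤ d)
    (t : F) (ht : t ≠ 0) (x : Fin d → F) : ‖hat ψ (ker w t) x‖ ^ 2 ≤ 4 * (Fintype.card F : ℝ) ^ (d - 1) := by
  rw [hat_ker hF hψ w hw (by omega)]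
  have hb := twisted_bound hF hψ (-t) (-∑ i, x i ^ 2 / (4 * w i)) (neg_ne_zero.2 ht) d (by omega)
  set S := ∑ s : F, eta F s ^ d * ψ (-t * s + (-∑ i, x i ^ 2 / (4 * w i)) * s⁻¹)
  have hq : (0 : ℝ) < Fintype.card F := by exact_mod_cast Fintype.card_pos
  have hS : ‖S‖ ^ 2 ≤ 4 * Fintype.card F := by
    have := pow_le_pow_left₀ (norm_nonneg _) hb 2
    rw [mul_pow, Real.sq_sqrt hq.le] at this
    linarith
  have hP : ‖∏ i, eta F (w i)‖ = 1 := by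
    rw [norm_prod]; exact prod_eq_one fun i _ => norm_eta (hw i)
  rw [norm_mul, norm_mul, norm_mul, hP, norm_pow, mul_pow, mul_pow, mul_pow, ← pow_mul, mul_comm d 2, pow_mul, norm_GS hF hψ]
  simp only [norm_div, norm_one, Complex.norm_natCast, one_pow, one_mul, div_pow]
  obtain ⟨e, rfl⟩ : ∃ e, d = e + 1 := ⟨d - 1, by omega⟩
  simp only [Nat.add_sub_cancel]
  calc _ ≤ 1 / (Fintype.card F : ℝ) ^ 2 * (Fintype.card F : ℝ) ^ (e + 1) * (4 * Fintype.card F) := by gcongr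
    _ = _ := by
      field_simp
      try ring

end Fourier

lemma op_bound_aux {F : Type*} [Field F] [Fintype F] [DecidableEq F] {d m : ℕ} (hF : ringChar F ≠ 2) (hm : 1 ≤ m)
    (Q : (Fin d → F) → F) (w : Fin m → F) (hw : ∀ i, w i ≠ 0) (e : (Fin d → F) ≃ₗ[F] (Fin m → F))
    (he : ∀ v, Q v = ∑ i, w i * (e v i) ^ 2)
    (t : F) (ht : t ≠ 0) (g : (Fin d → F) → ℝ) :
    ∑ u, (∑ y, ((if Q (u - y) = t then 1 else 0) - 1 / (Fintype.card F : ℝ)) * g y) ^ 2 ≤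
      4 * (Fintype.card F : ℝ) ^ (m - 1) * ∑ y, g y ^ 2 := by
  obtain ⟨ψ, hψ⟩ : ∃ ψ : AddChar F ℂ, ψ.IsPrimitive :=
    ⟨_, AddChar.FiniteField.primitiveChar_to_Complex_isPrimitive F⟩
  have h := conv_bound hψ (ker w t) (fun y => ((g (e.symm y) : ℝ) : ℂ)) (4 * (Fintype.card F : ℝ) ^ (m - 1))
    (hat_ker_bound hF hψ w hw hm t ht)
  have h1 : ∑ y, ‖((g (e.symm y) : ℝ) : ℂ)‖ ^ 2 = ∑ y, g y ^ 2 := by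
    refine Fintype.sum_equiv e.symm.toEquiv _ _ fun y => ?_
    simp
  have h2 : ∑ u, ‖∑ y, ker w t (u - y) * ((g (e.symm y) : ℝ) : ℂ)‖ ^ 2 =
      ∑ u, (∑ y, ((if Q (u - y) = t then 1 else 0) - 1 / (Fintype.card F : ℝ)) * g y) ^ 2 := by
    refine Fintype.sum_equiv e.symm.toEquiv _ _ fun u => ?_
    have h3 : ∑ y, ker w t (u - y) * ((g (e.symm y) : ℝ) : ℂ) =
      ((∑ y, ((if Q (e.symm u - y) = t then 1 else 0) - 1 / (Fintype.card F : ℝ)) * g y : ℝ) : ℂ) := by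
      rw [Complex.ofReal_sum]
      refine Fintype.sum_equiv e.symm.toEquiv _ _ fun y => ?_
      have h4 : Q (e.symm u - e.symm y) = ∑ i, w i * ((u - y) i) ^ 2 := by
        rw [he, map_sub]; simp
      simp only [LinearEquiv.coe_toEquiv, ker, h4]
      split_ifs <;> push_cast <;> rfl
    rw [h3, Complex.norm_real, Real.norm_eq_abs, sq_abs]
    rfl
  rw [h1, h2] at h
  exact h

/-- the operator norm bound -/
theorem op_bound {F : Type*} [Field F] [Fintype F] [DecidableEq F] {d : ℕ} (hF : ringChar F ≠ 2) (hd : 1 ≤ d)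
    (Q : QuadraticForm F (Fin d → F)) (hQ : ∀ x, (∀ y, QuadraticMap.polar (⇑Q) x y = 0) → x = 0)
    (t : F) (ht : t ≠ 0) (g : (Fin d → F) → ℝ) :
    ∑ u, (∑ y, ((if Q (u - y) = t then 1 else 0) - 1 / (Fintype.card F : ℝ)) * g y) ^ 2 ≤
      4 * (Fintype.card F : ℝ) ^ (d - 1) * ∑ y, g y ^ 2 := by
  classical
  have h2 : (2 : F) ≠ 0 := Ring.two_ne_zero hF
  let : Invertible (2 : F) := invertibleOfNonzero h2
  have hsep : (QuadraticMap.associated (R := F) Q).SeparatingLeft := by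
    intro x hx
    apply hQ
    intro y
    have := hx y
    rw [QuadraticMap.associated_apply] at this
    rw [QuadraticMap.polar]
    rw [smul_eq_zero] at this
    exact this.resolve_left (Invertible.ne_zero _)
  obtain ⟨w, ⟨e⟩⟩ := QuadraticForm.equivalent_weightedSumSquares_units_of_nondegenerate' Q hsep
  have hfr : Module.finrank F (Fin d → F) = d := Module.finrank_fin_fun F
  have h := op_bound_aux hF (by omega) (⇑Q) (fun i => (w i : F)) (fun i => (w i).ne_zero) e.toLinearEquiv ?_ t ht g
  · rw [hfr] at h
    exact h
  · intro v
    have := e.map_app v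
    rw [QuadraticMap.weightedSumSquares_apply] at this
    rw [← this]
    refine sum_congr rfl fun i _ => ?_
    rw [pow_two]
    rfl
end Kloo

open Finset
namespace Kloo

section Trace
variable {ι : Type*} [Fintype ι] [DecidableEq ι]

lemma walk_sum (A : Matrix ι ι ℝ) (m : ℕ) : ∀ B : Matrix ι ι ℝ,
    ∑ x : Fin (m + 1) → ι, (∏ i : Fin m, A (x i.castSucc) (x i.succ)) * B (x (Fin.last m)) (x 0) =
      (A ^ m * B).trace := by
  induction m with
  | zero =>
    intro B
    rw [← (Equiv.funUnique (Fin 1) ι).symm.sum_comp]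
    simp [Matrix.trace]
  | succ m ih =>
    intro B
    rw [← (Fin.consEquiv (fun _ : Fin (m + 2) => ι)).sum_comp, Fintype.sum_prod_type, sum_comm]
    have h := ih (B * A)
    rw [pow_succ', mul_assoc, Matrix.trace_mul_comm A, mul_assoc, ← h]
    refine sum_congr rfl fun y _ => ?_
    rw [Matrix.mul_apply, mul_sum]
    refine sum_congr rfl fun z _ => ?_
    rw [Fin.prod_univ_succ]
    simp only [Fin.consEquiv_apply, Fin.castSucc_zero, Fin.cons_zero, Fin.cons_succ, ← Fin.succ_last,
      ← Fin.succ_castSucc]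
    ring

lemma cycle_sum (A : Matrix ι ι ℝ) (m : ℕ) :
    ∑ x : Fin (m + 1) → ι, ∏ i, A (x i) (x (finRotate (m + 1) i)) = (A ^ (m + 1)).trace := by
  rw [pow_succ, ← walk_sum]
  refine sum_congr rfl fun x _ => ?_
  rw [Fin.prod_univ_castSucc, finRotate_last]
  congr 1
  refine prod_congr rfl fun i _ => ?_
  rw [finRotate_apply, Fin.coeSucc_eq_succ]

open scoped Matrix.Norms.L2Operator

lemma bilin_bound (X : Matrix ι ι ℝ) (u v : ι → ℝ) :
    |u ⬝ᵥ (X.mulVec v)| ≤ ‖X‖ * √(∑ i, u i ^ 2) * √(∑ i, v i ^ 2) := by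
  have h1 := Matrix.l2_opNorm_mulVec X (WithLp.toLp 2 v)
  have h2 : |u ⬝ᵥ (X.mulVec v)| ≤ √(∑ i, u i ^ 2) * √(∑ i, (X.mulVec v) i ^ 2) := by
    rw [← Real.sqrt_mul (by positivity)]
    apply Real.abs_le_sqrt
    exact sum_mul_sq_le_sq_mul_sq _ _ _
  rw [EuclideanSpace.norm_eq, EuclideanSpace.norm_eq] at h1
  simp only [Real.norm_eq_abs, sq_abs] at h1
  calc _ ≤ _ := h2
    _ ≤ √(∑ i, u i ^ 2) * (‖X‖ * √(∑ i, v i ^ 2)) := by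
      gcongr
      exact h1
    _ = _ := by ring

lemma norm_le_of (X : Matrix ι ι ℝ) (c : ℝ) (hc : 0 ≤ c)
    (h : ∀ g : ι → ℝ, ∑ i, (X.mulVec g) i ^ 2 ≤ c ^ 2 * ∑ i, g i ^ 2) : ‖X‖ ≤ c := by
  rw [Matrix.l2_opNorm_def]
  refine ContinuousLinearMap.opNorm_le_bound _ hc fun g => ?_
  rw [EuclideanSpace.norm_eq, EuclideanSpace.norm_eq, ← Real.sqrt_sq hc, ← Real.sqrt_mul (by positivity)]
  apply Real.sqrt_le_sqrt
  have := h (WithLp.ofLp g)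
  simpa using this

/-- sum of entries -/
def S (X : Matrix ι ι ℝ) : ℝ := (1 : ι → ℝ) ⬝ᵥ (X.mulVec 1)

lemma S_bound (X : Matrix ι ι ℝ) : |S X| ≤ Fintype.card ι * ‖X‖ := by
  have := bilin_bound X 1 1
  unfold S
  refine this.trans (le_of_eq ?_)
  simp only [Pi.one_apply, one_pow, sum_const, card_univ, nsmul_eq_mul, mul_one]
  rw [mul_assoc, Real.mul_self_sqrt (by positivity)]; ring

lemma S_add (X Y : Matrix ι ι ℝ) : S (X + Y) = S X + S Y := by
  simp [S, Matrix.add_mulVec]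

lemma S_eq (X : Matrix ι ι ℝ) : S X = ∑ i, ∑ j, X i j := by
  simp [S, Matrix.mulVec, dotProduct]

/-- constant matrix -/
noncomputable def Bm (ι : Type*) (q : ℝ) : Matrix ι ι ℝ := fun _ _ => 1 / q

lemma trace_mul_B (X : Matrix ι ι ℝ) (q : ℝ) : (X * Bm ι q).trace = S X / q := by
  rw [S_eq]
  simp [Matrix.trace, Matrix.mul_apply, Bm, sum_mul, div_eq_mul_inv]

lemma B_mulVec_one (q : ℝ) : (Bm ι q).mulVec 1 = ((Fintype.card ι : ℝ) / q) • (1 : ι → ℝ) := by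
  ext i
  simp [Matrix.mulVec, dotProduct, Bm, div_eq_mul_inv]

lemma S_B_pow (q : ℝ) (m : ℕ) : S (Bm ι q ^ m) = Fintype.card ι * ((Fintype.card ι : ℝ) / q) ^ m := by
  have : ∀ m, (Bm ι q ^ m).mulVec 1 = (((Fintype.card ι : ℝ) / q) ^ m) • (1 : ι → ℝ) := by
    intro m
    induction m with
    | zero => simp
    | succ m ih => rw [pow_succ, ← Matrix.mulVec_mulVec, B_mulVec_one, Matrix.mulVec_smul, ih, smul_smul, pow_succ']
  rw [S, this]
  simp [dotProduct, mul_comm]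

lemma norm_B (q : ℝ) (hq : 0 < q) : ‖Bm ι q‖ ≤ (Fintype.card ι : ℝ) / q := by
  refine norm_le_of _ _ (by positivity) fun g => ?_
  have h : ∀ i, (Bm ι q).mulVec g i = (∑ j, g j) / q := by
    intro i; simp [Matrix.mulVec, dotProduct, Bm, sum_mul, div_eq_mul_inv, mul_comm]
  simp only [h, sum_const, card_univ, nsmul_eq_mul]
  have h2 : (∑ j, g j) ^ 2 ≤ Fintype.card ι * ∑ j, g j ^ 2 := by
    simpa using sq_sum_le_card_mul_sum_sq (s := (univ : Finset ι)) (f := g)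
  rw [div_pow, div_pow]
  calc _ = ((Fintype.card ι : ℝ) / q ^ 2) * (∑ j, g j) ^ 2 := by ring
    _ ≤ ((Fintype.card ι : ℝ) / q ^ 2) * (Fintype.card ι * ∑ j, g j ^ 2) := by gcongr
    _ = _ := by ring

variable [Nonempty ι]

lemma norm_pow_le_of {X : Matrix ι ι ℝ} {c : ℝ} (h : ‖X‖ ≤ c) (m : ℕ) : ‖X ^ m‖ ≤ c ^ m := by
  have : ‖(1 : Matrix ι ι ℝ)‖ ≤ 1 := by
    refine norm_le_of _ _ zero_le_one fun g => ?_
    simp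
  have hc : 0 ≤ c := (norm_nonneg _).trans h
  induction m with
  | zero => simpa using this
  | succ m ih =>
    rw [pow_succ, pow_succ]
    exact (norm_mul_le _ _).trans (mul_le_mul ih h (norm_nonneg _) (by positivity))

lemma tel1 (A : Matrix ι ι ℝ) (q l : ℝ) (hq : 0 < q) (hM : ‖A - Bm ι q‖ ≤ l) (m : ℕ) :
    ∀ X : Matrix ι ι ℝ, |((A ^ m - (A - Bm ι q) ^ m) * X).trace| ≤
      (((Fintype.card ι : ℝ) / q + l) ^ m - l ^ m) * ‖X‖ := by
  set b := (Fintype.card ι : ℝ) / q with hb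
  have hl : 0 ≤ l := (norm_nonneg _).trans hM
  have hb0 : 0 ≤ b := by positivity
  have hA : ‖A‖ ≤ b + l := by
    calc ‖A‖ = ‖Bm ι q + (A - Bm ι q)‖ := by congr 1; abel
      _ ≤ _ := (norm_add_le _ _).trans (add_le_add (norm_B q hq) hM)
  induction m with
  | zero => intro X; simp
  | succ m ih =>
    intro X
    have h1 : (A ^ (m + 1) - (A - Bm ι q) ^ (m + 1)) * X =
      A ^ m * Bm ι q * X + (A ^ m - (A - Bm ι q) ^ m) * ((A - Bm ι q) * X) := by
      rw [pow_succ, pow_succ]; noncomm_ring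
    rw [h1, Matrix.trace_add, mul_assoc, Matrix.trace_mul_comm, mul_assoc, Matrix.trace_mul_comm, trace_mul_B]
    have h2 := ih ((A - Bm ι q) * X)
    have h3 : ‖(A - Bm ι q) * X‖ ≤ l * ‖X‖ := (norm_mul_le _ _).trans (by gcongr)
    have h4 : ‖X * A ^ m‖ ≤ ‖X‖ * (b + l) ^ m := (norm_mul_le _ _).trans (by
      have := norm_pow_le_of hA m
      gcongr)
    have h5 : |S (X * A ^ m) / q| ≤ b * (‖X‖ * (b + l) ^ m) := by
      rw [abs_div, abs_of_pos hq, div_le_iff₀ hq]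
      refine (S_bound _).trans ?_
      have : b * (‖X‖ * (b + l) ^ m) * q = Fintype.card ι * (‖X‖ * (b + l) ^ m) := by
        rw [hb]; field_simp
      rw [this]
      gcongr
    have h6 : 0 ≤ (b + l) ^ m - l ^ m := sub_nonneg.2 (pow_le_pow_left₀ hl (by linarith) m)
    have h7 := mul_le_mul_of_nonneg_left h3 h6
    refine (abs_add_le _ _).trans ?_
    calc _ ≤ b * (‖X‖ * (b + l) ^ m) + ((b + l) ^ m - l ^ m) * (l * ‖X‖) := add_le_add h5 (h2.trans h7)
      _ = _ := by rw [pow_succ, pow_succ]; ring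

lemma tel2 (A : Matrix ι ι ℝ) (q l : ℝ) (hq : 0 < q) (hM : ‖A - Bm ι q‖ ≤ l) (m : ℕ) :
    ‖A ^ m - Bm ι q ^ m‖ ≤ ((Fintype.card ι : ℝ) / q + l) ^ m - ((Fintype.card ι : ℝ) / q) ^ m := by
  set b := (Fintype.card ι : ℝ) / q with hb
  have hl : 0 ≤ l := (norm_nonneg _).trans hM
  have hb0 : 0 ≤ b := by positivity
  have hA : ‖A‖ ≤ b + l := by
    calc ‖A‖ = ‖Bm ι q + (A - Bm ι q)‖ := by congr 1; abel
      _ ≤ _ := (norm_add_le _ _).trans (add_le_add (norm_B q hq) hM)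
  induction m with
  | zero => simp
  | succ m ih =>
    have h1 : A ^ (m + 1) - Bm ι q ^ (m + 1) = A ^ m * (A - Bm ι q) + (A ^ m - Bm ι q ^ m) * Bm ι q := by
      rw [pow_succ, pow_succ]; noncomm_ring
    rw [h1]
    have h6 : 0 ≤ (b + l) ^ m - b ^ m := sub_nonneg.2 (pow_le_pow_left₀ hb0 (by linarith) m)
    calc _ ≤ ‖A ^ m * (A - Bm ι q)‖ + ‖(A ^ m - Bm ι q ^ m) * Bm ι q‖ := norm_add_le _ _
      _ ≤ (b + l) ^ m * l + ((b + l) ^ m - b ^ m) * b := by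
        refine add_le_add ((norm_mul_le _ _).trans ?_) ((norm_mul_le _ _).trans ?_)
        · exact mul_le_mul (norm_pow_le_of hA m) hM (norm_nonneg _) (by positivity)
        · exact mul_le_mul ih (norm_B q hq) (norm_nonneg _) h6
      _ = _ := by rw [pow_succ, pow_succ]; ring

lemma trace_sandwich (M X : Matrix ι ι ℝ) (hM : M.IsSymm) :
    |(M * X * M).trace| ≤ ‖X‖ * ∑ x, ∑ y, M x y ^ 2 := by
  have h : (M * X * M).trace = ∑ x, (M x) ⬝ᵥ (X.mulVec (M x)) := by
    rw [Matrix.trace]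
    refine sum_congr rfl fun x _ => ?_
    rw [Matrix.diag_apply, mul_assoc, Matrix.mul_apply_eq_vecMul, Matrix.vecMul, dotProduct, dotProduct]
    refine sum_congr rfl fun y _ => ?_
    rw [Matrix.mul_apply]
    congr 1
    rw [Matrix.mulVec, dotProduct]
    refine sum_congr rfl fun z _ => ?_
    rw [hM.apply]
  rw [h, mul_sum]
  refine (abs_sum_le_sum_abs _ _).trans (sum_le_sum fun x _ => ?_)
  refine (bilin_bound _ _ _).trans (le_of_eq ?_)
  rw [mul_assoc, Real.mul_self_sqrt (by positivity)]

lemma trace_main (A : Matrix ι ι ℝ) (hA : A.IsSymm) (h01 : ∀ x y, A x y ^ 2 = A x y)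
    (q l : ℝ) (hq : 1 ≤ q) (hM : ‖A - Bm ι q‖ ≤ l) (hl : l ≤ (Fintype.card ι : ℝ) / q) (m : ℕ) :
    |(A ^ (m + 2)).trace - ((Fintype.card ι : ℝ) / q) ^ (m + 2)| ≤
      3 * l ^ m * q * ((Fintype.card ι : ℝ) / q) ^ 2 +
        (((Fintype.card ι : ℝ) / q + l) ^ (m + 2) - ((Fintype.card ι : ℝ) / q) ^ (m + 2)) := by
  have hq0 : 0 < q := by linarith
  have hl0 : 0 ≤ l := (norm_nonneg _).trans hM
  set N := (Fintype.card ι : ℝ) with hN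
  have hNq : N = N / q * q := by field_simp
  set b := N / q with hb
  have hb0 : 0 ≤ b := by positivity
  have hMs : (A - Bm ι q).IsSymm := by
    ext i j; simp [Bm, hA.apply]
  -- square sum
  have hsq : ∑ x, ∑ y, (A - Bm ι q) x y ^ 2 ≤ 3 * q * b ^ 2 := by
    have e1 : ∀ x y, (A - Bm ι q) x y ^ 2 ≤ A x y + (1 / q) ^ 2 := by
      intro x y
      have h0 : 0 ≤ A x y := by rw [← h01]; positivity
      have : 0 ≤ A x y * (1 / q) := by positivity
      simp only [Matrix.sub_apply, Bm]
      nlinarith [h01 x y]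
    have e2 : ∑ x, ∑ y, (A - Bm ι q) x y ^ 2 ≤ S A + b ^ 2 := by
      rw [S_eq]
      refine (sum_le_sum fun x _ => sum_le_sum fun y _ => e1 x y).trans (le_of_eq ?_)
      simp only [sum_add_distrib, sum_const, card_univ, nsmul_eq_mul]
      rw [hb, hN]; field_simp
    have e3 : S A ≤ N * l + N * b := by
      have : A = (A - Bm ι q) + Bm ι q := by abel
      rw [this, S_add]
      have h1 := (le_abs_self _).trans (S_bound (A - Bm ι q))
      have h2 := S_B_pow (ι := ι) q 1
      rw [pow_one, pow_one] at h2
      rw [h2]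
      have : N * ‖A - Bm ι q‖ ≤ N * l := by gcongr
      linarith
    have e4 : N * l ≤ N * b := by gcongr
    have e5 : N * b = q * b ^ 2 := by rw [hNq]; ring
    have e6 : b ^ 2 ≤ q * b ^ 2 := by nlinarith [sq_nonneg b]
    linarith
  have t1 : |((A - Bm ι q) ^ (m + 2)).trace| ≤ 3 * l ^ m * q * b ^ 2 := by
    have : (A - Bm ι q) ^ (m + 2) = (A - Bm ι q) * (A - Bm ι q) ^ m * (A - Bm ι q) := by
      rw [pow_succ, pow_succ']
    rw [this]
    refine (trace_sandwich _ _ hMs).trans ?_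
    calc _ ≤ l ^ m * (3 * q * b ^ 2) := mul_le_mul (norm_pow_le_of hM m) hsq (by positivity) (by positivity)
      _ = _ := by ring
  have t2 := tel1 A q l hq0 hM (m + 1) (A - Bm ι q)
  have t3 := tel2 A q l hq0 hM (m + 1)
  rw [← hN, ← hb] at t2 t3
  have t4 : |S (A ^ (m + 1)) / q - b ^ (m + 2)| ≤ b * ((b + l) ^ (m + 1) - b ^ (m + 1)) := by
    have : A ^ (m + 1) = (A ^ (m + 1) - Bm ι q ^ (m + 1)) + Bm ι q ^ (m + 1) := by abel
    rw [this, S_add, S_B_pow, ← hN, ← hb]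
    have e : (S (A ^ (m + 1) - Bm ι q ^ (m + 1)) + N * b ^ (m + 1)) / q - b ^ (m + 2) =
        S (A ^ (m + 1) - Bm ι q ^ (m + 1)) / q := by
      rw [pow_succ b (m + 1), hb]; field_simp; ring
    rw [e, abs_div, abs_of_pos hq0, div_le_iff₀ hq0]
    refine (S_bound _).trans ?_
    calc _ ≤ N * ((b + l) ^ (m + 1) - b ^ (m + 1)) := by gcongr
      _ = _ := by nth_rewrite 1 [hNq]; ring
  have dec : (A ^ (m + 2)).trace = S (A ^ (m + 1)) / q +
      ((A ^ (m + 1) - (A - Bm ι q) ^ (m + 1)) * (A - Bm ι q)).trace + ((A - Bm ι q) ^ (m + 2)).trace := by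
    rw [← trace_mul_B, ← Matrix.trace_add, ← Matrix.trace_add]
    congr 1
    rw [pow_succ A (m + 1), pow_succ (A - Bm ι q) (m + 1)]
    noncomm_ring
  have t5 : ((b + l) ^ (m + 1) - l ^ (m + 1)) * ‖A - Bm ι q‖ ≤ (b + l) ^ (m + 1) * l := by
    have : (b + l) ^ (m + 1) - l ^ (m + 1) ≤ (b + l) ^ (m + 1) := by
      have : 0 ≤ l ^ (m + 1) := by positivity
      linarith
    exact mul_le_mul this hM (norm_nonneg _) (by positivity)
  rw [dec]
  have t6 : (b + l) ^ (m + 2) - b ^ (m + 2) = (b + l) ^ (m + 1) * l + b * ((b + l) ^ (m + 1) - b ^ (m + 1)) := by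
    rw [pow_succ, pow_succ b (m + 1)]; ring
  rw [t6]
  rw [abs_le] at *
  constructor <;> linarith [t1.1, t1.2, t2.1, t2.2, t4.1, t4.2]

end Trace
end Kloo

open Finset
namespace Kloo

section Final
open scoped Matrix.Norms.L2Operator

/-- adjacency matrix -/
noncomputable def adj {V F : Type*} [AddGroup V] [DecidableEq F] (Q : V → F) (t : F) (E : Finset V) : Matrix E E ℝ :=
  fun x y => if Q (x.1 - y.1) = t then 1 else 0

lemma count_eq {V F : Type*} [AddGroup V] [DecidableEq F] [DecidableEq V] (Q : V → F) (t : F) (E : Finset V) (m : ℕ) :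
    (Nat.card {x : Fin (m + 1) → V // (∀ i, x i ∈ E) ∧ ∀ i : Fin (m + 1), Q (x i - x (finRotate (m + 1) i)) = t} : ℝ) =
      (adj Q t E ^ (m + 1)).trace := by
  rw [← cycle_sum]
  let e : {x : Fin (m + 1) → V // (∀ i, x i ∈ E) ∧ ∀ i : Fin (m + 1), Q (x i - x (finRotate (m + 1) i)) = t} ≃
      {x : Fin (m + 1) → E // ∀ i : Fin (m + 1), Q ((x i).1 - (x (finRotate (m + 1) i)).1) = t} :=
    { toFun := fun x => ⟨fun i => ⟨x.1 i, x.2.1 i⟩, x.2.2⟩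
      invFun := fun x => ⟨fun i => (x.1 i).1, fun i => (x.1 i).2, x.2⟩
      left_inv := fun _ => rfl
      right_inv := fun _ => rfl }
  rw [Nat.card_congr e, Nat.card_eq_fintype_card, Fintype.card_subtype, card_filter, Nat.cast_sum]
  refine sum_congr rfl fun x _ => ?_
  simp only [adj, prod_ite_zero, mem_univ, true_implies]
  split_ifs <;> simp

lemma adj_norm {F : Type*} [Field F] [Fintype F] [DecidableEq F] {d : ℕ} (hF : ringChar F ≠ 2) (hd : 1 ≤ d)
    (Q : QuadraticForm F (Fin d → F)) (hQ : ∀ x, (∀ y, QuadraticMap.polar (⇑Q) x y = 0) → x = 0)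
    (t : F) (ht : t ≠ 0) (E : Finset (Fin d → F)) :
    ‖adj (⇑Q) t E - Bm E (Fintype.card F : ℝ)‖ ≤ 2 * √((Fintype.card F : ℝ) ^ (d - 1)) := by
  refine norm_le_of _ _ (by positivity) fun g => ?_
  let g' : (Fin d → F) → ℝ := fun y => if h : y ∈ E then g ⟨y, h⟩ else 0
  have hg' : ∀ y : E, g' y.1 = g y := fun y => by simp [g']
  have hg0 : ∀ y ∉ E, g' y = 0 := fun y hy => by simp [g', hy]
  have h := op_bound hF hd Q hQ t ht g'
  have h1 : ∑ y, g' y ^ 2 = ∑ y, g y ^ 2 := by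
    rw [← sum_subset (subset_univ E) (fun y _ hy => by rw [hg0 y hy]; ring), ← sum_coe_sort E]
    exact sum_congr rfl fun y _ => by rw [hg']
  have h2 : ∀ u : E, ((adj (⇑Q) t E - Bm E (Fintype.card F : ℝ)).mulVec g) u =
      ∑ y, ((if Q (u.1 - y) = t then 1 else 0) - 1 / (Fintype.card F : ℝ)) * g' y := by
    intro u
    rw [← sum_subset (subset_univ E) (fun y _ hy => by rw [hg0 y hy]; ring), ← sum_coe_sort E]
    exact sum_congr rfl fun y _ => by rw [hg']; rfl
  simp only [h2]
  rw [mul_pow, Real.sq_sqrt (by positivity), ← h1]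
  refine le_trans ?_ (h.trans (le_of_eq (by ring)))
  rw [sum_coe_sort E (fun u => (∑ y, ((if Q (u - y) = t then 1 else 0) - 1 / (Fintype.card F : ℝ)) * g' y) ^ 2)]
  exact sum_le_sum_of_subset_of_nonneg (subset_univ _) fun _ _ _ => sq_nonneg _

lemma graph_main {F : Type*} [Field F] [Fintype F] {d : ℕ} (hF : ringChar F ≠ 2) (hd : 1 ≤ d)
    (Q : QuadraticForm F (Fin d → F)) (hQ : ∀ x, (∀ y, QuadraticMap.polar (⇑Q) x y = 0) → x = 0)
    (t : F) (ht : t ≠ 0) (E : Finset (Fin d → F)) (hE : 0 < E.card) (m : ℕ)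
    (l b q : ℝ) (hq : q = Fintype.card F) (hb : b = E.card / q) (hl : l = 2 * √(q ^ (d - 1))) (hlb : l ≤ b) :
    |(Nat.card {x : Fin (m + 2) → (Fin d → F) // (∀ i, x i ∈ E) ∧
            ∀ i : Fin (m + 2), Q (x i - x (finRotate (m + 2) i)) = t} : ℝ) - b ^ (m + 2)| ≤
      3 * l ^ m * q * b ^ 2 + ((b + l) ^ (m + 2) - b ^ (m + 2)) := by
  classical
  have : Nonempty E := (card_pos.1 hE).to_subtype
  rw [count_eq (⇑Q) t E (m + 1)]
  have hN := adj_norm hF hd Q hQ t ht E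
  rw [← hq, ← hl] at hN
  have hc : (Fintype.card E : ℝ) = E.card := by rw [Fintype.card_coe]
  have hq1 : 1 ≤ q := by rw [hq]; exact_mod_cast Fintype.card_pos
  have hs : (adj (⇑Q) t E).IsSymm := by
    ext i j
    simp only [Matrix.transpose_apply, adj]
    rw [← neg_sub, QuadraticMap.map_neg]
  have := trace_main (adj (⇑Q) t E) hs (fun x y => by simp only [adj]; split_ifs <;> simp) q l hq1 hN
    (by rw [hc, ← hb]; exact hlb) m
  rw [hc, ← hb] at this
  exact this

lemma pow_aux (a : ℝ) (h0 : 0 ≤ a) (h1 : a ≤ 1) (n : ℕ) : (1 + a) ^ n - 1 ≤ 2 ^ n * a := by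
  have h : (1 + a) ^ n ≤ 1 + (2 ^ n - 1) * a := by
    induction n with
    | zero => simp
    | succ n ih =>
      have h2 : (1 : ℝ) ≤ 2 ^ n := one_le_pow₀ (by norm_num)
      rw [pow_succ, pow_succ]
      have h3 := mul_le_mul_of_nonneg_right ih (by linarith : 0 ≤ 1 + a)
      have h4 : 0 ≤ (2 ^ n - 1) * a * (1 - a) := mul_nonneg (mul_nonneg (by linarith) h0) (by linarith)
      nlinarith
  linarith

lemma num_main (m : ℕ) (b l q r τ : ℝ) (hb : 0 ≤ b) (hl0 : 0 ≤ l) (hq : 0 ≤ q) (hr : 0 ≤ r)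
    (hl : l ≤ 2 * r * b) (h1 : r ^ m * q = τ) (h2 : 2 ^ (m + 3) * r ≤ τ) (h3 : τ ≤ 1) :
    3 * l ^ m * q * b ^ 2 + ((b + l) ^ (m + 2) - b ^ (m + 2)) ≤ (3 * 2 ^ m + 1) * b ^ (m + 2) * τ := by
  have e1 : l ^ m ≤ 2 ^ m * r ^ m * b ^ m := by
    rw [← mul_pow, ← mul_pow]; exact pow_le_pow_left₀ hl0 hl m
  have e2 : 3 * l ^ m * q * b ^ 2 ≤ 3 * 2 ^ m * b ^ (m + 2) * τ := by
    rw [← h1, pow_add]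
    calc _ ≤ 3 * (2 ^ m * r ^ m * b ^ m) * q * b ^ 2 := by gcongr
      _ = _ := by ring
  have hp : (1 : ℝ) ≤ 2 ^ (m + 2) := one_le_pow₀ (by norm_num)
  have e3 : 2 ^ (m + 2) * (2 * r) ≤ τ := by
    refine le_trans (le_of_eq ?_) h2
    ring
  have e4 : 2 * r ≤ 1 := by nlinarith
  have e5 := pow_aux (2 * r) (by linarith) e4 (m + 2)
  have e6 : (b + l) ^ (m + 2) ≤ b ^ (m + 2) * (1 + 2 * r) ^ (m + 2) := by
    rw [← mul_pow]
    exact pow_le_pow_left₀ (by linarith) (by nlinarith) _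
  have e7 : b ^ (m + 2) * ((1 + 2 * r) ^ (m + 2) - 1) ≤ b ^ (m + 2) * τ := by
    gcongr
    linarith
  nlinarith

end Final
end Kloo

/-- Counting `n`-cycles (`n ≥ 5`) for sufficiently large odd `q`,
with a weaker restriction on the size of `E`.  Here `k = ⌊n/2⌋ = n / 2` (natural
division), and `finRotate n i = i + 1` cyclically. -/
theorem stmt14 (d n : ℕ) (hd : 2 ≤ d) (hn : 5 ≤ n)
    (δ : ℝ) (hδ0 : 0 < δ) (hδ : δ < 1 / (2 * ((n / 2 : ℕ) : ℝ) ^ 2)) :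
    ∃ Q₀ : ℕ, ∀ (F : Type) [Field F] [Fintype F],
      Q₀ ≤ Fintype.card F → Odd (Fintype.card F) →
      ∀ Q : QuadraticForm F (Fin d → F),
        (∀ x, (∀ y, QuadraticMap.polar (⇑Q) x y = 0) → x = 0) →
      ∀ t : F, t ≠ 0 →
      ∀ E : Finset (Fin d → F),
        (if Even n then
            (E.card : ℝ) ≥ (Fintype.card F : ℝ) ^
              ((1 / 2 : ℝ) * ((d : ℝ) + 2 -
                (((n / 2 : ℕ) : ℝ) - 2) / (((n / 2 : ℕ) : ℝ) - 1) + δ))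
          else
            (E.card : ℝ) ≥ (Fintype.card F : ℝ) ^
              ((1 / 2 : ℝ) * ((d : ℝ) + 2 -
                (2 * ((n / 2 : ℕ) : ℝ) - 3) / (2 * ((n / 2 : ℕ) : ℝ) - 1) + δ))) →
        |(Nat.card {x : Fin n → (Fin d → F) // (∀ i, x i ∈ E) ∧
            ∀ i : Fin n, Q (x i - x (finRotate n i)) = t} : ℝ) -
            (E.card : ℝ) ^ n / (Fintype.card F : ℝ) ^ n| ≤
          (36 + 80 * (6 : ℝ) ^ (n / 2 - 2) + 12 * ((n / 2 : ℕ) : ℝ)) *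
            ((E.card : ℝ) ^ n / (Fintype.card F : ℝ) ^ n) *
            (Fintype.card F : ℝ) ^ (-((n : ℝ) / 2 - 1) * δ) := by
  obtain ⟨m, rfl⟩ : ∃ m, n = m + 2 := ⟨n - 2, by omega⟩
  obtain ⟨j, hj⟩ : ∃ j, (m + 2) / 2 = j + 2 := ⟨(m + 2) / 2 - 2, by omega⟩
  rw [hj] at hδ ⊢
  have hmj : m ≤ 2 * j + 3 := by omega
  have hm0 : (0 : ℝ) < m := by exact_mod_cast (by omega : 0 < m)
  -- the exponent gap
  have hε : 0 < 1 / (m : ℝ) + δ / 2 - (m : ℝ) / 2 * δ := by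
    have hmj' : (m : ℝ) ≤ 2 * j + 3 := by exact_mod_cast hmj
    have hj0 : (0 : ℝ) ≤ j := by positivity
    rw [lt_div_iff₀ (by positivity)] at hδ
    push_cast at hδ
    have h1 : (m : ℝ) * (m - 1) * δ ≤ (2 * j + 3) * (2 * j + 2) * δ := by
      apply mul_le_mul_of_nonneg_right _ hδ0.le
      nlinarith
    have h2 : (m : ℝ) * (m - 1) * δ < 2 := by nlinarith
    have h3 : 1 / (m : ℝ) + δ / 2 - (m : ℝ) / 2 * δ = (2 - m * (m - 1) * δ) / (2 * m) := by
      field_simp; ring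
    rw [h3]
    apply div_pos <;> linarith
  set ε := 1 / (m : ℝ) + δ / 2 - (m : ℝ) / 2 * δ with hεd
  have hlim := (tendsto_rpow_atTop hε).comp (tendsto_natCast_atTop_atTop (R := ℝ))
  obtain ⟨Q₀, hQ₀⟩ := Filter.eventually_atTop.1 (hlim.eventually_ge_atTop ((2 : ℝ) ^ (m + 3)))
  refine ⟨Q₀, fun F _ _ hcard hodd Q hQ t ht E hE => ?_⟩
  have hF : ringChar F ≠ 2 := by
    intro h
    have := FiniteField.even_card_iff_char_two.1 h
    rw [Nat.odd_iff] at hodd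
    omega
  have hbig := hQ₀ _ hcard
  simp only [Function.comp] at hbig
  obtain ⟨q, hq⟩ : ∃ q : ℝ, q = (Fintype.card F : ℝ) := ⟨_, rfl⟩
  rw [← hq] at hbig hE ⊢
  have hq1 : 1 ≤ q := by rw [hq]; exact_mod_cast Fintype.card_pos
  have hq0 : 0 < q := by linarith
  have hE' : q ^ (((d : ℝ) + 1) / 2 + 1 / m + δ / 2) ≤ (E.card : ℝ) := by
    have key : ∀ x : ℝ, x = ((d : ℝ) + 1) / 2 + 1 / m + δ / 2 → (E.card : ℝ) ≥ q ^ x →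
      q ^ (((d : ℝ) + 1) / 2 + 1 / m + δ / 2) ≤ (E.card : ℝ) := by
      rintro x rfl h; exact h
    split_ifs at hE with hev
    · refine key _ ?_ hE
      have : m = 2 * j + 2 := by
        obtain ⟨c, hc⟩ := hev; omega
      have hm : (m : ℝ) = 2 * j + 2 := by exact_mod_cast this
      have : (0 : ℝ) ≤ j := by positivity
      rw [hm]; push_cast
      have : (j : ℝ) + 2 - 1 ≠ 0 := by linarith
      field_simp
      ring
    · refine key _ ?_ hE
      have : m = 2 * j + 3 := by
        rw [Nat.not_even_iff_odd] at hev
        obtain ⟨c, hc⟩ := hev; omega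
      have hm : (m : ℝ) = 2 * j + 3 := by exact_mod_cast this
      have : (0 : ℝ) ≤ j := by positivity
      rw [hm]; push_cast
      have : 2 * ((j : ℝ) + 2) - 1 ≠ 0 := by linarith
      field_simp
      ring
  set N := (E.card : ℝ) with hN
  have hN0 : 0 < N := lt_of_lt_of_le (Real.rpow_pos_of_pos hq0 _) hE'
  obtain ⟨b, hb⟩ : ∃ b : ℝ, b = N / q := ⟨_, rfl⟩
  obtain ⟨l, hl⟩ : ∃ l : ℝ, l = 2 * √(q ^ (d - 1)) := ⟨_, rfl⟩
  have hb0 : 0 < b := by rw [hb]; positivity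
  have hl0 : 0 ≤ l := by rw [hl]; positivity
  set r := q ^ (-(1 / (m : ℝ) + δ / 2)) with hr
  have hr0 : 0 < r := Real.rpow_pos_of_pos hq0 _
  set τ := q ^ (-(((m + 2 : ℕ) : ℝ) / 2 - 1) * δ) with hτ
  have hlb : l ≤ 2 * r * b := by
    have h1 : √(q ^ (d - 1)) = q ^ (((d : ℝ) - 1) / 2) := by
      rw [Real.sqrt_eq_rpow, ← Real.rpow_natCast, ← Real.rpow_mul hq0.le, Nat.cast_sub (by omega)]
      congr 1; push_cast; ring
    have h2 : q ^ (((d : ℝ) - 1) / 2) = r * (q ^ (((d : ℝ) + 1) / 2 + 1 / m + δ / 2) / q) := by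
      rw [hr, ← Real.rpow_sub_one hq0.ne', ← Real.rpow_add hq0]
      congr 1; ring
    rw [hl, h1, h2, hb, mul_assoc]
    gcongr
  have hrm : r ^ m * q = τ := by
    rw [hr, hτ, ← Real.rpow_natCast, ← Real.rpow_mul hq0.le, ← Real.rpow_add_one hq0.ne']
    congr 1; push_cast; field_simp; ring
  have hrτ : 2 ^ (m + 3) * r ≤ τ := by
    have : τ = q ^ ε * r := by
      rw [hτ, hr, ← Real.rpow_add hq0, hεd]
      congr 1; push_cast; ring
    rw [this]
    gcongr
  have hτ1 : τ ≤ 1 := by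
    apply Real.rpow_le_one_of_one_le_of_nonpos hq1
    push_cast
    nlinarith
  have hτ0 : 0 < τ := Real.rpow_pos_of_pos hq0 _
  have hlb1 : l ≤ b := by
    have hp : (1 : ℝ) ≤ 2 ^ (m + 2) := one_le_pow₀ (by norm_num)
    have e3 : 2 ^ (m + 2) * (2 * r) ≤ τ := by
      refine le_trans (le_of_eq ?_) hrτ
      ring
    have e4 : 2 * r ≤ 1 := by nlinarith
    nlinarith
  have hg := Kloo.graph_main hF (by omega) Q hQ t ht E (by rw [hN] at hN0; exact_mod_cast hN0) m l b q hq hb hl hlb1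
  have hnum := Kloo.num_main m b l q r τ hb0.le hl0 hq0.le hr0.le hlb hrm hrτ hτ1
  rw [← div_pow, ← hb]
  refine hg.trans (hnum.trans ?_)
  refine mul_le_mul_of_nonneg_right (mul_le_mul_of_nonneg_right ?_ (by positivity)) hτ0.le
  have h1 : (2 : ℝ) ^ m ≤ 8 * 6 ^ j := by
    calc (2 : ℝ) ^ m ≤ 2 ^ (2 * j + 3) := pow_le_pow_right₀ (by norm_num) hmj
      _ = 8 * 4 ^ j := by rw [pow_add, pow_mul]; norm_num; ring
      _ ≤ _ := by gcongr; norm_num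
  have h2 : (0 : ℝ) ≤ 6 ^ j := by positivity
  have h3 : (0 : ℝ) ≤ ((j + 2 : ℕ) : ℝ) := by positivity
  simp only [Nat.add_sub_cancel]
  linarith
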